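/- arXiv:2603.28299 — 3 statements merged into one kernel-verified Lean document; each statement's English description precedes it below -/
import Mathlib

section
/- Let 0<α<1, a<b, and let τ₅ ∈ C([a,b]). Define w₅(x,t)=∫_a^b G_α^{2α/3}(x−ξ,t)τ₅(ξ)dξ for x∈ℝ and t>0 (with G_α^{2α/3}(0,t) understood as its common one-sided limit t^{2α/3−1}/(3Γ(2α/3))). Then w₅ solves the homogeneous time-fractional Airy equation: for every x∈ℝ and t>0, ∂/∂t [J^{1−α}_{0,t} w₅(x,·)](t) = ∂³w₅/∂x³(x,t), i.e. the Riemann–Liouville fractional derivative of order α of w₅ in t equals its third spatial derivative, and both sides equal ∫_a^b G_α^{−α/3}(x−ξ,t)τ₅(ξ)dξ. -/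
open MeasureTheory Real Filter Set Topology

/-- Caputo fractional derivative of order `α` with base point `0`. -/
noncomputable def caputoD (α : ℝ) (g : ℝ → ℝ) (t : ℝ) : ℝ :=
  (1 / Real.Gamma (1 - α)) * ∫ ξ in (0:ℝ)..t, deriv g ξ / (t - ξ) ^ α

/-- Riemann–Liouville fractional integral of order `β` with base point `0`. -/
noncomputable def fracJ (β : ℝ) (g : ℝ → ℝ) (t : ℝ) : ℝ :=
  (1 / Real.Gamma β) * ∫ ξ in (0:ℝ)..t, g ξ * (t - ξ) ^ (β - 1)

/-- The Wright function `φ(λ, μ; z)`. -/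
noncomputable def wrightPhi (l μ z : ℂ) : ℂ :=
  ∑' n : ℕ, z ^ n / ((n.factorial : ℂ) * Complex.Gamma (l * n + μ))

/-- The cube root of unity `e^{2πi/3}`. -/
noncomputable def e23 : ℂ := Complex.exp (2 * Real.pi * Complex.I / 3)

/-- First fundamental solution `G_α^μ(x,t)` of the time-fractional Airy equation. -/
noncomputable def Gfun (α μ : ℝ) (x t : ℝ) : ℝ :=
  if x < 0 then
    (1/3) * t ^ (μ - 1) * (wrightPhi (-(α/3)) μ ((x / t ^ (α/3) : ℝ) : ℂ)).re
  else
    -(2/3) * t ^ (μ - 1) * (e23 * wrightPhi (-(α/3)) μ (e23 * ((x / t ^ (α/3) : ℝ) : ℂ))).re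

/-- Second fundamental solution `V_α^μ(x,t)` of the time-fractional Airy equation. -/
noncomputable def Vfun (α μ : ℝ) (x t : ℝ) : ℝ :=
  (1/3) * t ^ (μ - 1) * (e23 * wrightPhi (-(α/3)) μ (e23 * ((x / t ^ (α/3) : ℝ) : ℂ))).im

/-- `G_α^μ` extended across `x = 0` by its common one-sided limit. -/
noncomputable def Ghat (α μ : ℝ) (x t : ℝ) : ℝ :=
  if x = 0 then t ^ (μ - 1) / (3 * Real.Gamma μ) else Gfun α μ x t



lemma aux_young (d c m : ℝ) (hd0 : 0 < d) (hd1 : d < 1) (hc : 0 < c) (hm : 0 ≤ m) :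
    ∃ K : ℝ, ∀ s : ℝ, 0 ≤ s → m * s ^ d ≤ c * s + K := by
  refine ⟨c * (m / c) ^ (1 / (1 - d)), fun s hs => ?_⟩
  have h := Real.geom_mean_le_arith_mean2_weighted hd0.le (by linarith : (0:ℝ) ≤ 1 - d) hs
    (by positivity : 0 ≤ (m / c) ^ (1 / (1 - d))) (by ring)
  rw [← Real.rpow_mul (by positivity), one_div_mul_cancel (by linarith : (1 - d) ≠ 0),
    Real.rpow_one] at h
  have hK : 0 ≤ (m / c) ^ (1 / (1 - d)) := by positivity
  generalize (m / c) ^ (1 / (1 - d)) = K at *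
  have h2 : s ^ d * (m / c) ≤ s + K := by nlinarith
  have : s ^ d * (m/c) * c ≤ (s + K) * c := by gcongr
  rw [mul_assoc, div_mul_cancel₀ _ hc.ne'] at this
  linarith

lemma aux_intg0 (μ c : ℝ) (hμ : μ < 1) (hc : 0 < c) :
    IntegrableOn (fun s : ℝ => s ^ (-μ) * Real.exp (-c * s)) (Ioi 0) := by
  have := integrableOn_rpow_mul_exp_neg_mul_rpow (s := -μ) (p := 1) (b := c) (by linarith)
    one_pos hc
  simpa using this

lemma aux_intg (d μ c m : ℝ) (hd0 : 0 < d) (hd1 : d < 1) (hμ : μ < 1) (hc : 0 < c) (hm : 0 ≤ m) :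
    IntegrableOn (fun s : ℝ => s ^ (-μ) * Real.exp (-c * s + m * s ^ d)) (Ioi 0) := by
  obtain ⟨K, hK⟩ := aux_young d (c/2) m hd0 hd1 (by linarith) hm
  refine Integrable.mono' ((aux_intg0 μ (c/2) hμ (by linarith)).const_mul (Real.exp K)) ?_ ?_
  · apply Measurable.aestronglyMeasurable
    fun_prop
  · refine (ae_restrict_iff' measurableSet_Ioi).mpr (ae_of_all _ fun s hs => ?_)
    have hs' : (0:ℝ) < s := hs
    rw [Real.norm_of_nonneg (by positivity), mul_left_comm, ← Real.exp_add]
    refine mul_le_mul_of_nonneg_left (Real.exp_le_exp.mpr ?_) (by positivity)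
    have := hK s hs'.le
    linarith

lemma aux_gammaH (a : ℂ) (ha : 0 < a.re) (r : ℂ) (hr : 0 < r.re) :
    ∫ u in Ioi (0:ℝ), (u : ℂ) ^ (a - 1) * Complex.exp (-r * u) =
      Complex.exp (-a * Complex.log r) * Complex.Gamma a := by
  set U : Set ℂ := {z | 0 < z.re} with hU
  have hUo : IsOpen U := isOpen_lt continuous_const Complex.continuous_re
  have hUc : IsPreconnected U := (convex_halfSpace_re_gt 0).isPreconnected
  have hnorm : ∀ (z : ℂ) (b : ℂ) (u : ℝ), 0 < u → ‖(u:ℂ)^b * Complex.exp (-z * u)‖ =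
      u ^ b.re * Real.exp (-z.re * u) := by
    intro z b u hu
    rw [norm_mul, Complex.norm_cpow_eq_rpow_re_of_pos hu, Complex.norm_exp]
    simp
  have hmeas : ∀ (z b : ℂ), AEStronglyMeasurable (fun u : ℝ => (u:ℂ)^b * Complex.exp (-z * u))
      (volume.restrict (Ioi 0)) := by
    intro z b
    apply Measurable.aestronglyMeasurable
    fun_prop
  have hd : DifferentiableOn ℂ (fun z => ∫ u in Ioi (0:ℝ), (u : ℂ) ^ (a - 1) * Complex.exp (-z * u)) U := by
    intro z hz
    have hz' : 0 < z.re := hz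
    have := hasDerivAt_integral_of_dominated_loc_of_deriv_le (μ := volume.restrict (Ioi (0:ℝ)))
      (F := fun z u => (u : ℂ) ^ (a - 1) * Complex.exp (-z * u))
      (F' := fun z u => (u : ℂ) ^ (a - 1) * (Complex.exp (-z * u) * (-u)))
      (x₀ := z) (s := Metric.ball z (z.re/2))
      (bound := fun u => u ^ (-(-a.re)) * Real.exp (-(z.re/2) * u))
      (Metric.ball_mem_nhds _ (by linarith)) (Eventually.of_forall fun w => hmeas w _) ?_ ?_ ?_ ?_ ?_
    · exact this.2.differentiableAt.differentiableWithinAt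
    · refine Integrable.mono' (aux_intg0 (-(a.re - 1)) z.re (by linarith) hz') (hmeas _ _) ?_
      refine (ae_restrict_iff' measurableSet_Ioi).mpr (ae_of_all _ fun u hu => ?_)
      rw [hnorm _ _ _ hu]
      simp
    · apply Measurable.aestronglyMeasurable
      fun_prop
    · refine (ae_restrict_iff' measurableSet_Ioi).mpr (ae_of_all _ fun u hu w hw => ?_)
      have hu' : (0:ℝ) < u := hu
      rw [← mul_assoc, norm_mul, hnorm _ _ _ hu]
      have h1 : z.re/2 ≤ w.re := by
        have := (Complex.abs_re_le_norm (w - z))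
        rw [Metric.mem_ball, dist_eq_norm] at hw
        have h3 := abs_le.mp (this.trans hw.le)
        simp at h3
        linarith [h3.1]
      simp only [norm_neg, Complex.norm_real, Real.norm_of_nonneg hu'.le]
      rw [mul_right_comm, Complex.sub_re, Complex.one_re, ← Real.rpow_add_one hu'.ne']
      rw [show a.re - 1 + 1 = - -a.re by ring]
      gcongr
    · exact aux_intg0 _ _ (by linarith) (by linarith)
    · refine ae_of_all _ fun u w hw => ?_
      have : HasDerivAt (fun w : ℂ => -w * (u:ℂ)) (-(u:ℂ)) w := by
        simpa using ((hasDerivAt_id w).neg.mul_const (u:ℂ))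
      exact this.cexp.const_mul _
  have hd2 : DifferentiableOn ℂ (fun z => Complex.exp (-a * Complex.log z) * Complex.Gamma a) U := by
    intro z hz
    have : z ∈ Complex.slitPlane := Or.inl hz
    exact (((Complex.differentiableAt_log this).const_mul (-a)).cexp.mul_const _).differentiableWithinAt
  have hreal : ∀ r : ℝ, 0 < r → ∫ u in Ioi (0:ℝ), (u : ℂ) ^ (a - 1) * Complex.exp (-(r:ℂ) * u) =
      Complex.exp (-a * Complex.log r) * Complex.Gamma a := by
    intro r hr
    have := Complex.integral_cpow_mul_exp_neg_mul_Ioi ha hr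
    simp only [neg_mul] at this ⊢
    rw [this]
    congr 1
    have hr0 : (r:ℂ) ≠ 0 := by exact_mod_cast hr.ne'
    rw [Complex.cpow_def_of_ne_zero (by simpa using hr0), one_div, Complex.log_inv]
    · ring_nf
    · rw [Complex.arg_ofReal_of_nonneg hr.le]; exact Real.pi_pos.ne
  have := AnalyticOnNhd.eqOn_of_preconnected_of_frequently_eq (hd.analyticOnNhd hUo)
    (hd2.analyticOnNhd hUo) hUc (z₀ := 1) (by simp [hU]) ?_
  · exact this hr
  · have ht : Tendsto (fun n : ℕ => (((1 + 1/((n:ℝ)+1) : ℝ)) : ℂ)) atTop (𝓝[≠] 1) := by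
      rw [tendsto_nhdsWithin_iff]
      constructor
      · have := (tendsto_one_div_add_atTop_nhds_zero_nat (𝕜 := ℝ)).const_add 1
        have := (Complex.continuous_ofReal.tendsto _).comp this
        simpa [Function.comp_def] using this
      · refine Eventually.of_forall fun n => ?_
        simp only [mem_compl_iff, mem_singleton_iff]
        intro h
        have : (1 + 1/((n:ℝ)+1) : ℝ) = 1 := by exact_mod_cast h
        have : 0 < 1/((n:ℝ)+1) := by positivity
        linarith
    refine ht.frequently (Frequently.of_forall fun n => ?_)
    exact hreal _ (by positivity)

lemma hasSum_cg {f g : ℕ → ℂ} {a : ℂ} (h : HasSum g a) (e : ∀ n, f n = g n) : HasSum f a := by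
  rwa [funext e]

/-- the ray integral -/
noncomputable def rayI (d μ : ℝ) (q z : ℂ) : ℂ :=
  ∫ s in Ioi (0:ℝ), (s:ℂ) ^ (-μ : ℂ) * Complex.exp (-q * s + z * ((s ^ d : ℝ) : ℂ))

lemma rayI_hasSum (d μ : ℝ) (hd0 : 0 < d) (hd1 : d < 1) (hμ : μ < 1) (q z : ℂ) (hq : 0 < q.re) :
    HasSum (fun n : ℕ => z ^ n / (n.factorial : ℂ) *
      (Complex.exp (-(1 - μ + d * n) * Complex.log q) * Complex.Gamma (1 - μ + d * n)))
      (rayI d μ q z) := by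
  have key := hasSum_integral_of_dominated_convergence (μ := volume.restrict (Ioi (0:ℝ)))
    (F := fun (n : ℕ) (s : ℝ) => z ^ n / (n.factorial : ℂ) *
      ((s:ℂ) ^ ((1 - μ + d * n : ℂ) - 1) * Complex.exp (-q * s)))
    (f := fun s : ℝ => (s:ℂ) ^ (-μ : ℂ) * Complex.exp (-q * s + z * ((s ^ d : ℝ) : ℂ)))
    (bound := fun (n : ℕ) (s : ℝ) => s ^ (-μ) * Real.exp (-q.re * s) *
      ((‖z‖ * s ^ d) ^ n / (n.factorial : ℝ))) ?_ ?_ ?_ ?_ ?_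
  · refine hasSum_cg key (fun n => ?_)
    rw [integral_const_mul, aux_gammaH _ ?_ q hq]
    have h : (0:ℝ) ≤ d * n := by positivity
    have : (1 - μ + d * n : ℂ).re = 1 - μ + d * n := by simp
    rw [this]; linarith
  · intro n
    apply Measurable.aestronglyMeasurable
    fun_prop
  · intro n
    refine (ae_restrict_iff' measurableSet_Ioi).mpr (ae_of_all _ fun s hs => ?_)
    have hs' : (0:ℝ) < s := hs
    rw [norm_mul, norm_mul, norm_div, norm_pow, Complex.norm_cpow_eq_rpow_re_of_pos hs',
      Complex.norm_exp]
    have e1 : ((1 - μ + d * n : ℂ) - 1).re = -μ + d * n := by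
      simp; ring
    have e2 : (-q * (s:ℂ)).re = -q.re * s := by simp
    rw [e1, e2, Real.rpow_add hs', Real.rpow_mul hs'.le, Real.rpow_natCast, mul_pow]
    simp only [Complex.norm_natCast]
    apply le_of_eq; ring
  · refine (ae_restrict_iff' measurableSet_Ioi).mpr (ae_of_all _ fun s hs => ?_)
    exact (Real.summable_pow_div_factorial _).mul_left _
  · have : ∀ s : ℝ, ∑' n : ℕ, s ^ (-μ) * Real.exp (-q.re * s) *
      ((‖z‖ * s ^ d) ^ n / (n.factorial : ℝ)) = s ^ (-μ) * Real.exp (-q.re * s + ‖z‖ * s ^ d) := by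
      intro s
      rw [tsum_mul_left, Real.exp_add, Real.exp_eq_exp_ℝ, NormedSpace.exp_eq_tsum_div, mul_assoc]
    simp_rw [this]
    exact aux_intg d μ q.re ‖z‖ hd0 hd1 hμ hq (norm_nonneg _)
  · refine (ae_restrict_iff' measurableSet_Ioi).mpr (ae_of_all _ fun s hs => ?_)
    have hs' : (0:ℝ) < s := hs
    have h1 : HasSum (fun n : ℕ => (z * ((s ^ d : ℝ) : ℂ)) ^ n / (n.factorial : ℂ))
        (Complex.exp (z * ((s ^ d : ℝ) : ℂ))) := by
      rw [Complex.exp_eq_exp_ℂ]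
      exact NormedSpace.expSeries_div_hasSum_exp _
    have h2 := h1.mul_left ((s:ℂ) ^ (-μ : ℂ) * Complex.exp (-q * s))
    rw [mul_assoc, ← Complex.exp_add] at h2
    refine hasSum_cg h2 (fun n => ?_)
    have hs0 : (s:ℂ) ≠ 0 := by exact_mod_cast hs'.ne'
    rw [show ((1 - μ + d * n : ℂ) - 1) = -μ + d * n by ring, Complex.cpow_add _ _ hs0,
      Complex.cpow_mul_nat, mul_pow, Complex.ofReal_cpow hs'.le]
    ring

lemma log_expI (η : ℝ) (h1 : -(π/2) < η) (h2 : η < π/2) :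
    Complex.log (Complex.exp (η * Complex.I)) = η * Complex.I := by
  have := Real.pi_pos
  apply Complex.log_exp <;> simp <;> linarith

lemma re_expI (η : ℝ) : (Complex.exp (η * Complex.I)).re = Real.cos η := by
  rw [Complex.exp_ofReal_mul_I_re]

/-- reflection in exponential form -/
lemma inv_Gamma_exp (w : ℂ) (hw : 0 < (1 - w).re) : (Complex.Gamma w)⁻¹ = 1 / (2 * π * Complex.I) *
    (Complex.exp (π * w * Complex.I) - Complex.exp (-(π * w * Complex.I))) * Complex.Gamma (1 - w) := by
  have hG : Complex.Gamma (1 - w) ≠ 0 := Complex.Gamma_ne_zero_of_re_pos hw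
  have h := Complex.Gamma_mul_Gamma_one_sub w
  have hpi : (π : ℂ) ≠ 0 := by exact_mod_cast Real.pi_ne_zero
  have hs : Complex.exp (π * w * Complex.I) - Complex.exp (-(π * w * Complex.I)) =
    2 * Complex.I * Complex.sin (π * w) := by
    rw [Complex.sin, neg_mul]
    have := Complex.I_sq
    linear_combination (Complex.exp (π * w * Complex.I) - Complex.exp (-(π * w * Complex.I))) * this
  rw [hs]
  have h2 := congrArg (·⁻¹) h
  simp only [mul_inv, inv_div] at h2
  rw [eq_comm, ← mul_left_inj' (inv_ne_zero hG), h2]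
  field_simp

noncomputable def thA (d : ℝ) : ℝ := π / (1 + 3 * d)
noncomputable def etA (d : ℝ) : ℝ := π - thA d

noncomputable def rayC (d μ : ℝ) : ℂ := Complex.exp ((etA d + thA d * μ) * Complex.I)
noncomputable def rayC' (d μ : ℝ) : ℂ := Complex.exp (-((etA d + thA d * μ) * Complex.I))

lemma thA_facts (d : ℝ) (hd0 : 0 < d) (hd1 : d < 1/3) : 0 < etA d ∧ etA d < π/2 ∧ 0 < d * thA d ∧
    d * thA d < π / 6 := by
  have := Real.pi_pos
  have h : thA d * (1 + 3 * d) = π := by unfold thA; field_simp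
  have h0 : 0 < thA d := by unfold thA; positivity
  unfold etA
  refine ⟨by nlinarith, by nlinarith, by positivity, by nlinarith⟩

noncomputable def wterm (d μ : ℝ) (z : ℂ) (n : ℕ) : ℂ :=
  z ^ n / ((n.factorial : ℂ) * Complex.Gamma (-(d:ℂ) * n + μ))

lemma wright_rep (d μ : ℝ) (hd0 : 0 < d) (hd1 : d < 1/3) (hμ : μ < 1) (z : ℂ) :
    HasSum (wterm d μ z)
      (1 / (2 * π * Complex.I) * (
        rayC d μ * rayI d μ (Complex.exp ((etA d : ℝ) * Complex.I))
          (z * Complex.exp (((-(d * thA d) : ℝ) : ℂ) * Complex.I)) -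
        rayC' d μ * rayI d μ (Complex.exp (((-etA d : ℝ) : ℂ) * Complex.I))
          (z * Complex.exp (((d * thA d : ℝ) : ℂ) * Complex.I)))) := by
  obtain ⟨h1, h2, h3, h4⟩ := thA_facts d hd0 hd1
  have hp := Real.pi_pos
  have a1 := (rayI_hasSum d μ hd0 (by linarith) hμ (Complex.exp ((etA d : ℝ) * Complex.I))
    (z * Complex.exp (((-(d * thA d) : ℝ) : ℂ) * Complex.I)) (by
      rw [re_expI]; apply Real.cos_pos_of_mem_Ioo; constructor <;> linarith)).mul_left (rayC d μ)
  have a2 := (rayI_hasSum d μ hd0 (by linarith) hμ (Complex.exp (((-etA d : ℝ) : ℂ) * Complex.I))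
    (z * Complex.exp (((d * thA d : ℝ) : ℂ) * Complex.I)) (by
      rw [re_expI]; apply Real.cos_pos_of_mem_Ioo; constructor <;> linarith)).mul_left (rayC' d μ)
  have a3 := (a1.sub a2).mul_left (1 / (2 * π * Complex.I) : ℂ)
  refine hasSum_cg a3 (fun n => ?_)
  have hdn : (0:ℝ) ≤ d * n := by positivity
  unfold wterm
  rw [log_expI _ (by linarith) (by linarith), log_expI _ (by linarith) (by linarith),
    div_eq_mul_inv, mul_inv, inv_Gamma_exp _ (by simp; linarith)]
  have hth : (thA d : ℂ) = π - etA d := by unfold etA; push_cast; ring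
  have e1 : Complex.exp (π * (-(d:ℂ) * n + μ) * Complex.I) = rayC d μ *
     Complex.exp (((-(d * thA d) : ℝ) : ℂ) * Complex.I) ^ n *
     Complex.exp (-(1 - μ + d * n) * (((etA d : ℝ) : ℂ) * Complex.I)) := by
    rw [rayC, ← Complex.exp_nat_mul, ← Complex.exp_add, ← Complex.exp_add]
    congr 1
    push_cast
    rw [hth]
    ring
  have e2 : Complex.exp (-(π * (-(d:ℂ) * n + μ) * Complex.I)) = rayC' d μ *
     Complex.exp (((d * thA d : ℝ) : ℂ) * Complex.I) ^ n *
     Complex.exp (-(1 - μ + d * n) * (((-etA d : ℝ) : ℂ) * Complex.I)) := by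
    rw [rayC', ← Complex.exp_nat_mul, ← Complex.exp_add, ← Complex.exp_add]
    congr 1
    push_cast
    rw [hth]
    ring
  rw [e1, e2, show (1 - (-(d:ℂ) * n + μ)) = 1 - μ + d * n by ring, mul_pow, mul_pow]
  ring

lemma wterm_summable (d μ : ℝ) (hd0 : 0 < d) (hd1 : d < 1/3) (hμ : μ < 1) (z : ℂ) :
    Summable (wterm d μ z) := (wright_rep d μ hd0 hd1 hμ z).summable

noncomputable def Wr (d μ : ℝ) (z : ℂ) : ℂ := ∑' n, wterm d μ z n

lemma wright_eq (α μ : ℝ) (z : ℂ) : wrightPhi (-(α/3)) μ z = Wr (α/3) μ z := by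
  unfold wrightPhi Wr wterm
  push_cast
  rfl

lemma Wr_zero (d μ : ℝ) : Wr d μ 0 = (Complex.Gamma μ)⁻¹ := by
  unfold Wr
  rw [tsum_eq_single 0]
  · simp [wterm]
  · intro n hn; simp [wterm, hn]

lemma Wr_hasDerivAt (d μ : ℝ) (hd0 : 0 < d) (hd1 : d < 1/3) (hμ : μ < 1) (z : ℂ) :
    HasDerivAt (Wr d μ) (Wr d (μ - d) z) z := by
  set g' : ℕ → ℂ → ℂ := fun n y => (n * y ^ (n-1)) / ((n.factorial : ℂ) * Complex.Gamma (-(d:ℂ) * n + μ))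
  have hshift : ∀ y n, g' (n+1) y = wterm d (μ - d) y n := by
    intro y n
    simp only [g', wterm, Nat.add_sub_cancel, Nat.factorial_succ]
    push_cast
    have : (n:ℂ) + 1 ≠ 0 := by exact_mod_cast Nat.succ_ne_zero n
    rw [show (-(d:ℂ) * (n+1) + μ) = -d * n + (μ - d) by ring, mul_assoc ((n:ℂ)+1),
      mul_div_mul_left _ _ this]
  have hsum : ∀ y, Summable (fun n => g' n y) := by
    intro y
    rw [← summable_nat_add_iff 1]
    simp_rw [hshift]
    exact wterm_summable d (μ - d) hd0 hd1 (by linarith) y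
  have key := hasDerivAt_tsum_of_isPreconnected (g := fun n y => wterm d μ y n) (g' := g')
    (u := fun n => ‖g' n ((‖z‖ + 1 : ℝ) : ℂ)‖) (t := Metric.ball 0 (‖z‖ + 1)) (y₀ := 0) (y := z)
    (hsum _).norm Metric.isOpen_ball (convex_ball _ _).isPreconnected ?_ ?_
    (by simp; positivity) (wterm_summable d μ hd0 hd1 hμ 0) (by simp)
  · have e : Wr d (μ - d) z = ∑' n, g' n z := ?_
    · rw [e]; exact key
    rw [(hsum z).tsum_eq_zero_add]
    simp_rw [hshift]
    simp [g', Wr]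
  · intro n y hy
    exact (hasDerivAt_pow n y).div_const _
  · intro n y hy
    simp only [g', norm_div, norm_mul, norm_pow, Complex.norm_real]
    have : ‖y‖ ≤ ‖z‖ + 1 := by simpa using (Metric.mem_ball.mp hy).le
    rw [Real.norm_of_nonneg (by positivity : 0 ≤ ‖z‖ + 1)]
    gcongr

lemma Wr_rec (d μ : ℝ) (hd0 : 0 < d) (hd1 : d < 1/3) (hμ : μ < 1) (z : ℂ) :
    (μ - 1) * Wr d μ z - d * z * Wr d (μ - d) z = Wr d (μ - 1) z := by
  set h : ℕ → ℂ := fun n => d * n * wterm d μ z n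
  have hshift : ∀ n, h (n+1) = d * z * wterm d (μ - d) z n := by
    intro n
    simp only [h, wterm, Nat.factorial_succ]
    push_cast
    have : (n:ℂ) + 1 ≠ 0 := by exact_mod_cast Nat.succ_ne_zero n
    rw [show (-(d:ℂ) * (n+1) + μ) = -d * n + (μ - d) by ring, mul_assoc ((n:ℂ)+1),
      mul_assoc, mul_div_assoc', mul_div_mul_left _ _ this]
    ring
  have s1 := wterm_summable d (μ - d) hd0 hd1 (by linarith) z
  have s0 := wterm_summable d μ hd0 hd1 hμ z
  have hsum : Summable h := by
    rw [← summable_nat_add_iff 1]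
    simp_rw [hshift]
    exact s1.mul_left _
  have e : d * z * Wr d (μ - d) z = ∑' n, h n := by
    rw [hsum.tsum_eq_zero_add]
    simp_rw [hshift]
    rw [tsum_mul_left]
    simp [h, Wr]
  rw [e, Wr, Wr, ← tsum_mul_left, ← (s0.mul_left _).tsum_sub hsum]
  congr 1
  funext n
  simp only [h, wterm]
  have := Complex.one_div_Gamma_eq_self_mul_one_div_Gamma_add_one (-(d:ℂ) * n + (μ - 1 : ℝ))
  push_cast at this ⊢
  rw [show -(d:ℂ) * n + (μ - 1) + 1 = -d * n + μ by ring] at this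
  rw [div_eq_mul_inv, div_eq_mul_inv, mul_inv, mul_inv, this]
  ring

lemma rayI_norm (d μ : ℝ) (q z : ℂ) (s : ℝ) (hs : 0 < s) :
    ‖(s:ℂ) ^ (-μ : ℂ) * Complex.exp (-q * s + z * ((s ^ d : ℝ) : ℂ))‖ =
    s ^ (-μ) * Real.exp (-q.re * s + z.re * s ^ d) := by
  rw [norm_mul, Complex.norm_cpow_eq_rpow_re_of_pos hs, Complex.norm_exp]
  congr 2
  simp

lemma rayI_bound (d μ : ℝ) (hμ : μ < 1) (q z : ℂ) (hq : 0 < q.re) (hz : z.re ≤ 0) :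
    ‖rayI d μ q z‖ ≤ ∫ s in Ioi (0:ℝ), s ^ (-μ) * Real.exp (-q.re * s) := by
  refine norm_integral_le_of_norm_le (aux_intg0 μ q.re hμ hq) ?_
  refine (ae_restrict_iff' measurableSet_Ioi).mpr (ae_of_all _ fun s hs => ?_)
  have hs' : (0:ℝ) < s := hs
  rw [rayI_norm _ _ _ _ _ hs']
  refine mul_le_mul_of_nonneg_left (Real.exp_le_exp.mpr ?_) (by positivity)
  have : 0 ≤ s ^ d := by positivity
  nlinarith

lemma Wr_bound (d μ ω : ℝ) (hd0 : 0 < d) (hd1 : d < 1/3) (hμ : μ < 1) (hω : |ω| ≤ π/3) :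
    ∃ C, 0 ≤ C ∧ ∀ y : ℝ, 0 ≤ y → ‖Wr d μ (-(y:ℂ) * Complex.exp (ω * Complex.I))‖ ≤ C := by
  obtain ⟨h1, h2, h3, h4⟩ := thA_facts d hd0 hd1
  have hp := Real.pi_pos
  have hω' := abs_le.mp hω
  have hc1 : 0 < Real.cos (etA d) := by
    apply Real.cos_pos_of_mem_Ioo; constructor <;> linarith
  refine ⟨‖(1 / (2 * π * Complex.I) : ℂ)‖ * (
    ‖rayC d μ‖ * (∫ s in Ioi (0:ℝ), s ^ (-μ) * Real.exp (-Real.cos (etA d) * s)) +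
    ‖rayC' d μ‖ * (∫ s in Ioi (0:ℝ), s ^ (-μ) * Real.exp (-Real.cos (etA d) * s))), ?_, fun y hy => ?_⟩
  · have : 0 ≤ ∫ s in Ioi (0:ℝ), s ^ (-μ) * Real.exp (-Real.cos (etA d) * s) := by
      refine setIntegral_nonneg measurableSet_Ioi fun s hs => ?_
      have hs' : (0:ℝ) < s := hs
      positivity
    positivity
  · rw [Wr, (wright_rep d μ hd0 hd1 hμ _).tsum_eq, norm_mul]
    gcongr
    refine (norm_sub_le _ _).trans ?_
    rw [norm_mul, norm_mul]
    gcongr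
    · refine (rayI_bound d μ hμ _ _ (by rwa [re_expI]) ?_).trans (by rw [re_expI])
      rw [mul_assoc, ← Complex.exp_add, ← add_mul, ← Complex.ofReal_add, ← Complex.ofReal_neg,
        Complex.re_ofReal_mul, re_expI]
      have : 0 ≤ Real.cos (ω + -(d * thA d)) := by
        apply Real.cos_nonneg_of_mem_Icc; constructor <;> linarith
      nlinarith
    · refine (rayI_bound d μ hμ _ _ (by rwa [re_expI, Real.cos_neg]) ?_).trans
        (by rw [re_expI, Real.cos_neg])
      rw [mul_assoc, ← Complex.exp_add, ← add_mul, ← Complex.ofReal_add, ← Complex.ofReal_neg,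
        Complex.re_ofReal_mul, re_expI]
      have : 0 ≤ Real.cos (ω + (d * thA d)) := by
        apply Real.cos_nonneg_of_mem_Icc; constructor <;> linarith
      nlinarith

lemma rayI_mellin (d μ : ℝ) (hd0 : 0 < d) (q : ℂ) (hq : 0 < q.re) (ψ : ℝ)
    (hψ1 : -(π/2) < ψ) (hψ2 : ψ < π/2) (k : ℂ) (hk : 0 < k.re) (hμk : μ + d * k.re < 1) :
    IntegrableOn (fun y : ℝ => (y:ℂ) ^ (k-1) * rayI d μ q (-(y:ℂ) * Complex.exp (ψ * Complex.I))) (Ioi 0) ∧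
    ∫ y in Ioi (0:ℝ), (y:ℂ) ^ (k-1) * rayI d μ q (-(y:ℂ) * Complex.exp (ψ * Complex.I)) =
      Complex.Gamma k * Complex.exp (-k * (ψ * Complex.I)) *
       (Complex.exp (-(1 - μ - d * k) * Complex.log q) * Complex.Gamma (1 - μ - d * k)) := by
  set P := Complex.exp (ψ * Complex.I) with hP
  have hPre : 0 < P.re := by
    rw [hP, re_expI]; apply Real.cos_pos_of_mem_Ioo; constructor <;> linarith
  set F : ℝ → ℝ → ℂ := fun y s => (y:ℂ) ^ (k-1) *
    ((s:ℂ) ^ (-μ : ℂ) * Complex.exp (-q * s + (-(y:ℂ) * P) * ((s ^ d : ℝ) : ℂ))) with hF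
  have hnorm : ∀ y s : ℝ, 0 < y → 0 < s → ‖F y s‖ = (s ^ (-μ) * Real.exp (-q.re * s)) *
      (y ^ (k.re - 1) * Real.exp (-((P.re * s ^ d) * y))) := by
    intro y s hy hs
    rw [hF]
    simp only
    rw [norm_mul, rayI_norm _ _ _ _ _ hs, Complex.norm_cpow_eq_rpow_re_of_pos hy, Real.exp_add,
      ← Complex.ofReal_neg, Complex.re_ofReal_mul, Complex.sub_re, Complex.one_re,
      show -y * P.re * s ^ d = -((P.re * s ^ d) * y) by ring]
    ring
  have hmeas : AEStronglyMeasurable (Function.uncurry F)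
      ((volume.restrict (Ioi (0:ℝ))).prod (volume.restrict (Ioi (0:ℝ)))) := by
    apply Measurable.aestronglyMeasurable
    simp only [hF, Function.uncurry_def]
    fun_prop
  have hint : Integrable (Function.uncurry F)
      ((volume.restrict (Ioi (0:ℝ))).prod (volume.restrict (Ioi (0:ℝ)))) := by
    rw [integrable_prod_iff' hmeas]
    constructor
    · refine (ae_restrict_iff' measurableSet_Ioi).mpr (ae_of_all _ fun s hs => ?_)
      have hs' : (0:ℝ) < s := hs
      refine Integrable.mono' (((aux_intg0 (-(k.re - 1)) (P.re * s ^ d) (by linarith) (by positivity))).const_mul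
        (s ^ (-μ) * Real.exp (-q.re * s))) ?_ ?_
      · apply Measurable.aestronglyMeasurable
        simp only [hF, Function.uncurry_def]
        fun_prop
      · refine (ae_restrict_iff' measurableSet_Ioi).mpr (ae_of_all _ fun y hy => ?_)
        simp only [Function.uncurry_apply_pair]
        rw [hnorm y s hy hs]
        simp
    · refine Integrable.congr (f := fun s : ℝ => ((1 / P.re) ^ k.re * Real.Gamma k.re) *
        (s ^ (-(μ + d * k.re)) * Real.exp (-q.re * s)))
        ((aux_intg0 _ _ hμk hq).const_mul _) ?_
      refine (ae_restrict_iff' measurableSet_Ioi).mpr (ae_of_all _ fun s hs => ?_)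
      have hs' : (0:ℝ) < s := hs
      simp only [Function.uncurry_apply_pair]
      rw [setIntegral_congr_fun measurableSet_Ioi (fun y hy => hnorm y s hy hs), integral_const_mul,
        Real.integral_rpow_mul_exp_neg_mul_Ioi hk (by positivity), one_div, one_div, mul_inv,
        Real.mul_rpow (by positivity) (by positivity), neg_add, Real.rpow_add hs',
        ← Real.rpow_neg hs'.le, ← Real.rpow_mul hs'.le]
      ring_nf
  have hFy : ∀ y, ∫ s in Ioi (0:ℝ), F y s = (y:ℂ) ^ (k-1) * rayI d μ q (-(y:ℂ) * P) := by
    intro y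
    simp only [hF, rayI]
    rw [integral_const_mul]
  constructor
  · have := hint.integral_prod_left
    simp only [Function.uncurry_apply_pair] at this
    simp_rw [hFy] at this
    exact this
  · simp_rw [← hFy]
    rw [integral_integral_swap hint]
    have hin : ∀ s ∈ Ioi (0:ℝ), ∫ y in Ioi (0:ℝ), F y s = (Complex.Gamma k * Complex.exp (-k * (ψ * Complex.I))) *
        ((s:ℂ) ^ ((1 - μ - d * k) - 1) * Complex.exp (-q * s)) := by
      intro s hs
      have hs' : (0:ℝ) < s := hs
      have hs0 : (s:ℂ) ≠ 0 := by exact_mod_cast hs'.ne'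
      have e : ∀ y : ℝ, F y s = ((s:ℂ) ^ (-μ : ℂ) * Complex.exp (-q * s)) *
         ((y:ℂ) ^ (k-1) * Complex.exp (-(((s ^ d : ℝ) : ℂ) * P) * y)) := by
        intro y
        simp only [hF]
        rw [Complex.exp_add, show (-(y:ℂ) * P) * ((s ^ d : ℝ) : ℂ) = -(((s ^ d : ℝ) : ℂ) * P) * y by ring]
        ring
      simp_rw [e]
      rw [integral_const_mul, aux_gammaH k hk _ (by rw [Complex.re_ofReal_mul]; positivity),
        Complex.log_ofReal_mul (by positivity) (Complex.exp_ne_zero _), log_expI _ hψ1 hψ2,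
        show ((1 - μ - d * k : ℂ) - 1) = -μ + -(d * k) by ring, Complex.cpow_add _ _ hs0,
        mul_add, Complex.exp_add, Real.log_rpow hs', Complex.cpow_def_of_ne_zero hs0 (-(d*k)),
        ← Complex.ofReal_log hs'.le]
      push_cast
      ring_nf
    rw [setIntegral_congr_fun measurableSet_Ioi hin, integral_const_mul, aux_gammaH _ _ q hq]
    simp
    linarith

lemma Wr_mellin (d μ ω : ℝ) (hd0 : 0 < d) (hd1 : d < 1/3) (hω : |ω| ≤ π/3)
    (k : ℂ) (hk : 0 < k.re) (hμk : μ + d * k.re < 1) :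
    HasMellin (fun y : ℝ => Wr d μ (-(y:ℂ) * Complex.exp (ω * Complex.I))) k
      (Complex.Gamma k * Complex.exp (-k * (ω * Complex.I)) * (Complex.Gamma (μ + d * k))⁻¹) := by
  obtain ⟨h1, h2, h3, h4⟩ := thA_facts d hd0 hd1
  have hp := Real.pi_pos
  have hω' := abs_le.mp hω
  have hdk : 0 < d * k.re := by positivity
  have hμ : μ < 1 := by linarith
  have hc1 : 0 < Real.cos (etA d) := by
    apply Real.cos_pos_of_mem_Ioo; constructor <;> linarith
  obtain ⟨i1, v1⟩ := rayI_mellin d μ hd0 (Complex.exp ((etA d : ℝ) * Complex.I)) (by rwa [re_expI])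
    (ω + -(d * thA d)) (by linarith) (by linarith) k hk hμk
  obtain ⟨i2, v2⟩ := rayI_mellin d μ hd0 (Complex.exp (((-etA d : ℝ) : ℂ) * Complex.I))
    (by rwa [re_expI, Real.cos_neg])
    (ω + (d * thA d)) (by linarith) (by linarith) k hk hμk
  have e : ∀ y : ℝ, (y:ℂ)^(k-1) • Wr d μ (-(y:ℂ) * Complex.exp (ω * Complex.I)) =
    (1 / (2 * π * Complex.I) * rayC d μ) * ((y:ℂ) ^ (k-1) * rayI d μ (Complex.exp ((etA d : ℝ) * Complex.I))
       (-(y:ℂ) * Complex.exp ((ω + -(d * thA d) : ℝ) * Complex.I))) -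
    (1 / (2 * π * Complex.I) * rayC' d μ) * ((y:ℂ) ^ (k-1) * rayI d μ (Complex.exp (((-etA d : ℝ) : ℂ) * Complex.I))
       (-(y:ℂ) * Complex.exp ((ω + (d * thA d) : ℝ) * Complex.I))) := by
    intro y
    rw [Wr, (wright_rep d μ hd0 hd1 hμ _).tsum_eq, mul_assoc (-(y:ℂ)), mul_assoc (-(y:ℂ)), ← Complex.exp_add,
      ← Complex.exp_add, ← add_mul, ← add_mul, ← Complex.ofReal_add, ← Complex.ofReal_add, smul_eq_mul]
    ring
  constructor
  · unfold MellinConvergent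
    simp_rw [e]
    exact (i1.const_mul _).sub (i2.const_mul _)
  · unfold mellin
    simp_rw [e]
    rw [integral_sub (i1.const_mul _) (i2.const_mul _), integral_const_mul, integral_const_mul, v1, v2,
      log_expI _ (by linarith) (by linarith), log_expI _ (by linarith) (by linarith),
      inv_Gamma_exp _ (by simp; linarith)]
    have hth : (thA d : ℂ) = π - etA d := by unfold etA; push_cast; ring
    have e1 : Complex.exp (π * (μ + d * k) * Complex.I) * Complex.exp (-k * (ω * Complex.I)) = rayC d μ *
      Complex.exp (-k * (((ω + -(d * thA d) : ℝ) : ℂ) * Complex.I)) *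
      Complex.exp (-(1 - μ - d * k) * (((etA d : ℝ) : ℂ) * Complex.I)) := by
      rw [rayC, ← Complex.exp_add, ← Complex.exp_add, ← Complex.exp_add]
      congr 1
      push_cast
      rw [hth]
      ring
    have e2 : Complex.exp (-(π * (μ + d * k) * Complex.I)) * Complex.exp (-k * (ω * Complex.I)) = rayC' d μ *
      Complex.exp (-k * (((ω + (d * thA d) : ℝ) : ℂ) * Complex.I)) *
      Complex.exp (-(1 - μ - d * k) * (((-etA d : ℝ) : ℂ) * Complex.I)) := by
      rw [rayC', ← Complex.exp_add, ← Complex.exp_add, ← Complex.exp_add]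
      congr 1
      push_cast
      rw [hth]
      ring
    rw [show (1 - (μ + d * k) : ℂ) = 1 - μ - d * k by ring]
    linear_combination (-(1 / (2 * π * Complex.I) * Complex.Gamma k * Complex.Gamma (1 - μ - d * k))) * e1 +
      (1 / (2 * π * Complex.I) * Complex.Gamma k * Complex.Gamma (1 - μ - d * k)) * e2

lemma Wr_cont (d μ : ℝ) (hd0 : 0 < d) (hd1 : d < 1/3) (hμ : μ < 1) : Continuous (Wr d μ) :=
  continuous_iff_continuousAt.mpr fun z => (Wr_hasDerivAt d μ hd0 hd1 hμ z).continuousAt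

lemma beta_intg (μ β t : ℝ) (hμ : 0 < μ) (hβ : 0 < β) (ht : 0 < t) :
    IntegrableOn (fun s : ℝ => s ^ (μ - 1) * (t - s) ^ (β - 1)) (Ioo 0 t) := by
  have h1 : IntegrableOn (fun s : ℝ => s ^ (μ - 1) * (t - s) ^ (β - 1)) (Ioc 0 (t/2)) := by
    have a1 : IntervalIntegrable (fun s : ℝ => s ^ (μ - 1)) volume 0 (t/2) :=
      intervalIntegral.intervalIntegrable_rpow' (by linarith)
    have : IntervalIntegrable (fun s : ℝ => s ^ (μ - 1) * (t - s) ^ (β - 1)) volume 0 (t/2) := by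
      apply a1.mul_continuousOn
      rw [uIcc_of_le (by linarith)]
      intro s hs
      apply ContinuousAt.continuousWithinAt
      apply ContinuousAt.rpow_const (by fun_prop)
      left
      have := hs.2
      linarith
    exact (intervalIntegrable_iff_integrableOn_Ioc_of_le (by linarith)).mp this
  have h2 : IntegrableOn (fun s : ℝ => s ^ (μ - 1) * (t - s) ^ (β - 1)) (Ioc (t/2) t) := by
    have a1 : IntervalIntegrable (fun s : ℝ => s ^ (β - 1)) volume (t/2) 0 :=
      intervalIntegral.intervalIntegrable_rpow' (by linarith)
    have a2 := a1.comp_sub_left t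
    rw [sub_zero, show t - t/2 = t/2 by ring] at a2
    have : IntervalIntegrable (fun s : ℝ => s ^ (μ - 1) * (t - s) ^ (β - 1)) volume (t/2) t := by
      apply a2.continuousOn_mul
      rw [uIcc_of_le (by linarith)]
      intro s hs
      apply ContinuousAt.continuousWithinAt
      apply ContinuousAt.rpow_const (by fun_prop)
      left
      have := hs.1
      linarith
    exact (intervalIntegrable_iff_integrableOn_Ioc_of_le (by linarith)).mp this
  have := h1.union h2
  rw [Ioc_union_Ioc_eq_Ioc (by linarith) (by linarith)] at this
  exact this.mono_set Ioo_subset_Ioc_self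

lemma Wr_J (d μ β ω t y : ℝ) (hd0 : 0 < d) (hd1 : d < 1/3) (hω : |ω| ≤ π/3)
    (hμ0 : 0 < μ) (hβ : 0 < β) (hμ : μ + d < 1) (hμβ : μ + β + d/2 < 1) (ht : 0 < t) (hy : 0 < y) :
    ∫ s in Ioo 0 t, ((s ^ (μ - 1) * (t - s) ^ (β - 1) : ℝ) : ℂ) *
      Wr d μ (-((y * s ^ (-d) : ℝ) : ℂ) * Complex.exp (ω * Complex.I)) =
    Complex.Gamma β * (((t ^ (μ + β - 1) : ℝ) : ℂ) *
      Wr d (μ + β) (-((y * t ^ (-d) : ℝ) : ℂ) * Complex.exp (ω * Complex.I))) := by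
  set E := Complex.exp (ω * Complex.I) with hE
  set f : ℝ → ℂ := fun y => Wr d μ (-(y:ℂ) * E) with hf
  set g : ℝ → ℂ := fun y => Wr d (μ+β) (-(y:ℂ) * E) with hg
  set Φ : ℝ → ℝ := fun s => s ^ (μ - 1) * (t - s) ^ (β - 1) with hΦ
  have hΦi : IntegrableOn Φ (Ioo 0 t) := beta_intg μ β t hμ0 hβ ht
  have hΦm : Measurable Φ := by simp only [hΦ]; fun_prop
  have hΦ0 : ∀ s ∈ Ioo 0 t, 0 ≤ Φ s := by
    intro s hs
    have h1 := hs.1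
    have h2 : 0 < t - s := by linarith [hs.2]
    simp only [hΦ]; positivity
  have hfc : Continuous f := (Wr_cont d μ hd0 hd1 (by linarith)).comp (by fun_prop)
  have hgc : Continuous g := (Wr_cont d (μ+β) hd0 hd1 (by linarith)).comp (by fun_prop)
  obtain ⟨C, hC0, hC⟩ := Wr_bound d μ ω hd0 hd1 (by linarith) hω
  set Jf : ℝ → ℂ := fun y => ∫ s in Ioo 0 t, (Φ s : ℂ) * f (y * s ^ (-d)) with hJf
  -- continuity of Jf
  have hJc : ∀ y, 0 < y → ContinuousAt Jf y := by
    intro y hy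
    apply continuousAt_of_dominated (bound := fun s => Φ s * C)
    · refine Eventually.of_forall fun x => ?_
      apply Measurable.aestronglyMeasurable
      exact (Complex.measurable_ofReal.comp hΦm).mul (hfc.measurable.comp (by fun_prop))
    · filter_upwards [lt_mem_nhds hy] with x hx
      refine (ae_restrict_iff' measurableSet_Ioo).mpr (ae_of_all _ fun s hs => ?_)
      have h1 := hs.1
      rw [norm_mul, Complex.norm_real, Real.norm_of_nonneg (hΦ0 s hs)]
      exact mul_le_mul_of_nonneg_left (hC _ (by positivity)) (hΦ0 s hs)
    · exact hΦi.mul_const _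
    · refine ae_of_all _ fun s => ?_
      exact (continuous_const.mul (hfc.comp (by fun_prop))).continuousAt
  -- Mellin transform of Jf
  have hJm : ∀ k : ℂ, k.re = 1/2 → HasMellin Jf k (Complex.Gamma β *
      ((t:ℂ) ^ (μ + β - 1 + d * k) * (Complex.Gamma k * Complex.exp (-k * (ω * Complex.I)) * (Complex.Gamma (μ + β + d * k))⁻¹))) := by
    intro k hk
    obtain ⟨mc, mv⟩ := Wr_mellin d μ ω hd0 hd1 hω k (by linarith) (by rw [hk]; linarith)
    rw [← hE] at mc mv
    change MellinConvergent f k at mc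
    change mellin f k = _ at mv
    set F : ℝ → ℝ → ℂ := fun y s => (Φ s : ℂ) * ((y:ℂ)^(k-1) * f (y * s ^ (-d))) with hF
    have hFm : Measurable (Function.uncurry F) := by
      simp only [hF, Function.uncurry_def]
      refine (Complex.measurable_ofReal.comp (hΦm.comp measurable_snd)).mul (Measurable.mul (by fun_prop) ?_)
      exact hfc.measurable.comp (by fun_prop)
    have hint : Integrable (Function.uncurry F)
      ((volume.restrict (Ioi (0:ℝ))).prod (volume.restrict (Ioo (0:ℝ) t))) := by
      rw [integrable_prod_iff' hFm.aestronglyMeasurable]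
      constructor
      · refine (ae_restrict_iff' measurableSet_Ioo).mpr (ae_of_all _ fun s hs => ?_)
        have h1 := hs.1
        have h2 : 0 < s ^ (-d) := by positivity
        have := (MellinConvergent.comp_mul_left (f := f) (s := k) h2).mpr mc
        unfold MellinConvergent at this
        simp only [Function.uncurry_apply_pair, hF]
        refine Integrable.const_mul ?_ _
        simp_rw [mul_comm _ (s ^ (-d))]
        exact this
      · refine Integrable.congr (f := fun s : ℝ => (∫ x in Ioi (0:ℝ), x ^ (k.re - 1) * ‖f x‖) *
          (s ^ ((μ + d * k.re) - 1) * (t - s) ^ (β - 1))) ?_ ?_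
        · refine (beta_intg (μ + d * k.re) β t ?_ hβ ht).const_mul _
          rw [hk]; positivity
        · refine (ae_restrict_iff' measurableSet_Ioo).mpr (ae_of_all _ fun s hs => ?_)
          have h1 := hs.1
          have h2 : 0 < s ^ (-d) := by positivity
          have e : ∀ y ∈ Ioi (0:ℝ), ‖Function.uncurry F (y, s)‖ = (Φ s * (s ^ (-d)) ^ (1 - k.re)) *
              ((fun x : ℝ => x ^ (k.re - 1) * ‖f x‖) (y * s ^ (-d))) := by
            intro y hy
            have hy' : (0:ℝ) < y := hy
            simp only [Function.uncurry_apply_pair, hF]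
            rw [norm_mul, norm_mul, Complex.norm_real, Real.norm_of_nonneg (hΦ0 s hs),
              Complex.norm_cpow_eq_rpow_re_of_pos hy', Complex.sub_re, Complex.one_re,
              Real.mul_rpow hy'.le h2.le, show 1 - k.re = -(k.re - 1) by ring, Real.rpow_neg h2.le]
            have : (s ^ (-d)) ^ (k.re - 1) ≠ 0 := by positivity
            field_simp
          beta_reduce
          rw [setIntegral_congr_fun measurableSet_Ioi e, integral_const_mul,
            integral_comp_mul_right_Ioi (fun x : ℝ => x ^ (k.re - 1) * ‖f x‖) 0 h2, zero_mul, smul_eq_mul]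
          simp only [hΦ]
          have e3 : s ^ (μ + d * k.re - 1) = s ^ (μ - 1) * ((s ^ (-d)) ^ (1 - k.re) * (s ^ (-d))⁻¹) := by
            rw [← Real.rpow_neg h1.le, ← Real.rpow_mul h1.le, ← Real.rpow_add h1, ← Real.rpow_add h1]
            congr 1; ring
          rw [e3]; ring
    have hFy : ∀ y : ℝ, ∫ s in Ioo 0 t, F y s = (y:ℂ)^(k-1) • Jf y := by
      intro y
      simp only [hF, hJf, smul_eq_mul]
      rw [← integral_const_mul]
      congr 1; funext s; ring
    constructor
    · have := hint.integral_prod_left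
      simp only [Function.uncurry_apply_pair] at this
      simp_rw [hFy] at this
      exact this
    · unfold mellin
      simp_rw [← hFy]
      rw [integral_integral_swap hint]
      have hin : ∀ s ∈ Ioo (0:ℝ) t, ∫ y in Ioi (0:ℝ), F y s = 
        ((s:ℂ) ^ ((μ + d * k) - 1) * ((t:ℂ) - s) ^ ((β:ℂ) - 1)) * mellin f k := by
        intro s hs
        have h1 := hs.1
        have h3 : 0 < t - s := by linarith [hs.2]
        have h2 : 0 < s ^ (-d) := by positivity
        have hs0 : (s:ℂ) ≠ 0 := by exact_mod_cast h1.ne'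
        have := mellin_comp_mul_right f k h2
        simp only [hF]
        rw [integral_const_mul]
        change _ * mellin (fun y => f (y * s ^ (-d))) k = _
        rw [this]
        simp only [hΦ, smul_eq_mul]
        rw [Complex.ofReal_mul, Complex.ofReal_cpow h1.le, Complex.ofReal_cpow h3.le,
          Complex.ofReal_cpow h1.le, show (μ + d * k - 1 : ℂ) = (μ - 1) + d * k by ring,
          Complex.cpow_add _ _ hs0]
        have : ((s:ℂ) ^ ((-d : ℝ) : ℂ)) ^ (-k) = (s:ℂ) ^ (d * k) := by
          rw [← Complex.ofReal_cpow h1.le, Complex.cpow_def_of_ne_zero (by exact_mod_cast h2.ne'),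
            ← Complex.ofReal_log h2.le, Real.log_rpow h1, Complex.cpow_def_of_ne_zero hs0,
            ← Complex.ofReal_log h1.le]
          push_cast; ring_nf
        rw [this]
        push_cast; ring
      rw [setIntegral_congr_fun measurableSet_Ioo hin, integral_mul_const, ← integral_Ioc_eq_integral_Ioo,
        ← intervalIntegral.integral_of_le ht.le, Complex.betaIntegral_scaled _ _ ht, mv]
      have hr : 0 < (μ + d * k : ℂ).re := by simp; rw [hk]; positivity
      have B := Complex.Gamma_mul_Gamma_eq_betaIntegral hr (t := (β:ℂ)) (by simpa using hβ)
      have g1 : Complex.Gamma (μ + d * k) ≠ 0 := Complex.Gamma_ne_zero_of_re_pos hr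
      have g2 : Complex.Gamma (μ + d * k + β) ≠ 0 := Complex.Gamma_ne_zero_of_re_pos (by simp; rw [hk]; positivity)
      have B' : Complex.betaIntegral (μ + d * k) β = Complex.Gamma (μ + d * k) * Complex.Gamma β * (Complex.Gamma (μ + d * k + β))⁻¹ := by
        rw [B]; field_simp
      rw [B', show (μ + β + d * k : ℂ) = μ + d * k + β by ring, show (μ + β - 1 + d * k : ℂ) = μ + d * k + β - 1 by ring]
      field_simp
  set R : ℝ → ℂ := fun y => (Complex.Gamma β * ((t ^ (μ + β - 1) : ℝ) : ℂ)) • g (y * t ^ (-d)) with hR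
  have htd : 0 < t ^ (-d) := by positivity
  have ht0 : (t:ℂ) ≠ 0 := by exact_mod_cast ht.ne'
  have hRm : ∀ k : ℂ, k.re = 1/2 → HasMellin R k (Complex.Gamma β *
      ((t:ℂ) ^ (μ + β - 1 + d * k) * (Complex.Gamma k * Complex.exp (-k * (ω * Complex.I)) * (Complex.Gamma (μ + β + d * k))⁻¹))) := by
    intro k hk
    obtain ⟨mc, mv⟩ := Wr_mellin d (μ+β) ω hd0 hd1 hω k (by linarith) (by rw [hk]; linarith)
    rw [← hE] at mc mv
    change MellinConvergent g k at mc
    change mellin g k = _ at mv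
    have c1 := (MellinConvergent.comp_mul_left (f := g) (s := k) htd).mpr mc
    simp_rw [mul_comm (t ^ (-d))] at c1
    have c2 := hasMellin_const_smul c1 (Complex.Gamma β * ((t ^ (μ + β - 1) : ℝ) : ℂ))
    refine ⟨c2.1, c2.2.trans ?_⟩
    rw [mellin_comp_mul_right g k htd, mv, Complex.cpow_add _ _ ht0, Complex.ofReal_cpow ht.le]
    have : (((t ^ (-d) : ℝ)) : ℂ) ^ (-k) = (t:ℂ) ^ (d * k) := by
      rw [Complex.cpow_def_of_ne_zero (by exact_mod_cast htd.ne'),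
        ← Complex.ofReal_log htd.le, Real.log_rpow ht, Complex.cpow_def_of_ne_zero ht0,
        ← Complex.ofReal_log ht.le]
      push_cast; ring_nf
    rw [this]
    simp only [smul_eq_mul]
    push_cast
    ring
  have hDm : ∀ k : ℂ, k.re = 1/2 → HasMellin (fun y => Jf y - R y) k 0 := by
    intro k hk
    have := hasMellin_sub (hJm k hk).1 (hRm k hk).1
    rw [(hJm k hk).2, (hRm k hk).2, sub_self] at this
    exact this
  have hz : ∀ v : ℝ, mellin (fun y => Jf y - R y) ((1/2 : ℝ) + v * Complex.I) = 0 := by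
    intro v
    exact (hDm _ (by simp)).2
  have hinv := mellinInv_mellin_eq (1/2) (fun y => Jf y - R y) hy ?_ ?_ ?_
  · have h0 : mellinInv (1/2) (mellin fun y => Jf y - R y) y = 0 := by
      unfold mellinInv
      simp_rw [hz]
      simp
    rw [h0] at hinv
    have : Jf y = R y := (sub_eq_zero.mp hinv.symm)
    simp only [hJf, hR, hf, hg, smul_eq_mul] at this
    rw [this, mul_assoc]
  · exact (hDm _ (by simp)).1
  · unfold Complex.VerticalIntegrable
    simp_rw [hz]
    exact integrable_zero _ _ _
  · have hgc2 : Continuous (fun y : ℝ => g (y * t ^ (-d))) :=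
      hgc.comp (by fun_prop : Continuous fun y : ℝ => y * t ^ (-d))
    have hRc : Continuous R := by
      simp only [hR, smul_eq_mul]
      exact continuous_const.mul hgc2
    exact (hJc y hy).sub hRc.continuousAt

lemma e23_eq : e23 = ((-(1/2) : ℝ) : ℂ) + ((√3 / 2 : ℝ) : ℂ) * Complex.I := by
  unfold e23
  have hc : Real.cos (2 * π / 3) = -(1/2) := by
    rw [show 2 * π / 3 = π - π / 3 by ring, Real.cos_pi_sub, Real.cos_pi_div_three]
  have hs : Real.sin (2 * π / 3) = √3/2 := by
    rw [show 2 * π / 3 = π - π / 3 by ring, Real.sin_pi_sub, Real.sin_pi_div_three]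
  rw [show (2 * π * Complex.I / 3 : ℂ) = ((2 * π / 3 : ℝ) : ℂ) * Complex.I by push_cast; ring,
    Complex.exp_mul_I, ← Complex.ofReal_cos, ← Complex.ofReal_sin, hc, hs]

lemma e23_re : e23.re = -(1/2) := by rw [e23_eq]; simp [-Complex.ofReal_ofNat, -Complex.ofReal_div]

lemma e23_neg : e23 = -Complex.exp (((-(π/3) : ℝ) : ℂ) * Complex.I) := by
  unfold e23
  rw [← neg_one_mul, ← Complex.exp_pi_mul_I, ← Complex.exp_add]
  congr 1
  push_cast; ring

lemma e23_cube : e23 ^ 3 = 1 := by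
  unfold e23
  rw [← Complex.exp_nat_mul, ← Complex.exp_two_pi_mul_I]
  congr 1
  push_cast; ring

lemma e23_norm : ‖e23‖ = 1 := by
  rw [e23_neg, norm_neg, Complex.norm_exp_ofReal_mul_I]

lemma Ghat_eq (α μ x t : ℝ) : Ghat α μ x t = Gfun α μ x t := by
  unfold Ghat
  split_ifs with h
  · subst h
    unfold Gfun
    rw [if_neg (lt_irrefl _)]
    simp only [zero_div, Complex.ofReal_zero, mul_zero, wright_eq, Wr_zero]
    rw [Complex.Gamma_ofReal, ← Complex.ofReal_inv, mul_comm e23, Complex.re_ofReal_mul, e23_re]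
    rw [div_eq_mul_inv, mul_inv]
    ring
  · rfl

lemma Grep (α x : ℝ) : ∃ (κ : ℂ) (ω y : ℝ), ‖κ‖ ≤ 1 ∧ (ω = 0 ∨ ω = -(π/3)) ∧ 0 ≤ y ∧ (x ≠ 0 → 0 < y) ∧
    ∀ μ t : ℝ, 0 < t → Gfun α μ x t = (κ * (((t ^ (μ - 1) : ℝ) : ℂ) *
      Wr (α/3) μ (-((y * t ^ (-(α/3)) : ℝ) : ℂ) * Complex.exp (ω * Complex.I)))).re := by
  by_cases hx : x < 0
  · refine ⟨((1/3 : ℝ) : ℂ), 0, -x, ?_, Or.inl rfl, by linarith, fun _ => by linarith, fun μ t ht => ?_⟩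
    · rw [Complex.norm_real]; norm_num
    · unfold Gfun
      rw [if_pos hx, wright_eq, Complex.re_ofReal_mul, Complex.re_ofReal_mul, mul_assoc]
      congr 4
      rw [Real.rpow_neg ht.le]
      simp [div_eq_mul_inv]
  · refine ⟨((-(2/3) : ℝ) : ℂ) * e23, -(π/3), x, ?_, Or.inr rfl, by linarith, fun h => ?_, fun μ t ht => ?_⟩
    · rw [norm_mul, Complex.norm_real, e23_norm]; norm_num
    · exact lt_of_le_of_ne (by linarith) (Ne.symm h)
    · unfold Gfun
      rw [if_neg hx, wright_eq, mul_assoc ((-(2/3) : ℝ) : ℂ), Complex.re_ofReal_mul, mul_left_comm e23, Complex.re_ofReal_mul, mul_assoc]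
      congr 5
      rw [Real.rpow_neg ht.le, e23_neg, div_eq_mul_inv]
      push_cast; ring

lemma ω_le {ω : ℝ} (h : ω = 0 ∨ ω = -(π/3)) : |ω| ≤ π/3 := by
  have := Real.pi_pos
  rcases h with h | h
  · rw [h]; simp; positivity
  · rw [h, abs_neg, abs_of_pos (by positivity)]

lemma Gbound (α μ : ℝ) (h0 : 0 < α) (h1 : α < 1) (hμ : μ < 1) :
    ∃ C, 0 ≤ C ∧ ∀ x t : ℝ, 0 < t → |Gfun α μ x t| ≤ C * t ^ (μ - 1) := by
  have hp := Real.pi_pos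
  obtain ⟨C1, p1, b1⟩ := Wr_bound (α/3) μ 0 (by linarith) (by linarith) hμ (ω_le (Or.inl rfl))
  obtain ⟨C2, p2, b2⟩ := Wr_bound (α/3) μ (-(π/3)) (by linarith) (by linarith) hμ (ω_le (Or.inr rfl))
  refine ⟨C1 + C2, by linarith, fun x t ht => ?_⟩
  obtain ⟨κ, ω, y, hκ, hω, hy, -, h⟩ := Grep α x
  rw [h μ t ht]
  refine (Complex.abs_re_le_norm _).trans ?_
  have hyt : 0 ≤ y * t ^ (-(α/3)) := by positivity
  have hW : ‖Wr (α/3) μ (-((y * t ^ (-(α/3)) : ℝ) : ℂ) * Complex.exp (ω * Complex.I))‖ ≤ C1 + C2 := by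
    rcases hω with rfl | rfl
    · exact (b1 _ hyt).trans (by linarith)
    · exact (b2 _ hyt).trans (by linarith)
  have ht' : 0 < t ^ (μ - 1) := by positivity
  rw [norm_mul, norm_mul, Complex.norm_real, Real.norm_of_nonneg ht'.le]
  calc _ ≤ 1 * (t ^ (μ - 1) * (C1 + C2)) := by gcongr
    _ = _ := by ring

lemma G_meas (α μ : ℝ) (h0 : 0 < α) (h1 : α < 1) (hμ : μ < 1) :
    Measurable (fun p : ℝ × ℝ => Gfun α μ p.1 p.2) := by
  have hc := (Wr_cont (α/3) μ (by linarith) (by linarith) hμ).measurable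
  unfold Gfun
  simp_rw [wright_eq]
  refine Measurable.ite (measurableSet_lt measurable_fst measurable_const) ?_ ?_
  · refine Measurable.mul (by fun_prop) (Complex.measurable_re.comp (hc.comp (by fun_prop)))
  · refine Measurable.mul (by fun_prop) (Complex.measurable_re.comp ((hc.comp (by fun_prop)).const_mul _))

lemma G_J (α x t : ℝ) (h0 : 0 < α) (h1 : α < 1) (hx : x ≠ 0) (ht : 0 < t) :
    ∫ s in Ioo 0 t, Gfun α (2*α/3) x s * (t - s) ^ ((1 - α) - 1) = Real.Gamma (1 - α) * Gfun α (1 - α/3) x t := by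
  obtain ⟨κ, ω, y, hκ, hω, hy, hy', h⟩ := Grep α x
  have key := Wr_J (α/3) (2*α/3) (1 - α) ω t y (by linarith) (by linarith) (ω_le hω) (by linarith) (by linarith)
    (by linarith) (by linarith) ht (hy' hx)
  rw [show 2 * α / 3 + (1 - α) = 1 - α/3 by ring] at key
  set K : ℝ → ℂ := fun s => ((s ^ (2*α/3 - 1) * (t - s) ^ ((1 - α) - 1) : ℝ) : ℂ) *
      Wr (α/3) (2*α/3) (-((y * s ^ (-(α/3)) : ℝ) : ℂ) * Complex.exp (ω * Complex.I)) with hK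
  obtain ⟨C, p, b⟩ := Wr_bound (α/3) (2*α/3) ω (by linarith) (by linarith) (by linarith) (ω_le hω)
  have hKi : IntegrableOn K (Ioo 0 t) := by
    refine Integrable.mono' ((beta_intg (2*α/3) (1-α) t (by linarith) (by linarith) ht).mul_const C) ?_ ?_
    · have hc := (Wr_cont (α/3) (2*α/3) (by linarith) (by linarith) (by linarith)).measurable
      apply Measurable.aestronglyMeasurable
      exact Measurable.mul (by fun_prop) (hc.comp (by fun_prop))
    · refine (ae_restrict_iff' measurableSet_Ioo).mpr (ae_of_all _ fun s hs => ?_)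
      have e1 := hs.1
      have e2 : 0 < t - s := by linarith [hs.2]
      simp only [hK]
      rw [norm_mul, Complex.norm_real, Real.norm_of_nonneg (by positivity)]
      exact mul_le_mul_of_nonneg_left (b _ (by positivity)) (by positivity)
  have e : ∀ s ∈ Ioo 0 t, Gfun α (2*α/3) x s * (t - s) ^ ((1 - α) - 1) = (κ * K s).re := by
    intro s hs
    rw [h _ s hs.1, mul_comm, ← Complex.re_ofReal_mul]
    simp only [hK]
    push_cast
    congr 1
    ring
  have := integral_re (hKi.const_mul κ)
  simp only [RCLike.re_eq_complex_re] at this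
  rw [setIntegral_congr_fun measurableSet_Ioo e, this, integral_const_mul, key, h _ t ht, Complex.Gamma_ofReal,
    ← Complex.re_ofReal_mul]
  congr 1
  ring

lemma G_t (α μ x t : ℝ) (h0 : 0 < α) (h1 : α < 1) (hμ : μ < 1) (ht : 0 < t) :
    HasDerivAt (fun s => Gfun α μ x s) (Gfun α (μ - 1) x t) t := by
  obtain ⟨κ, ω, y, hκ, hω, hy, hy', h⟩ := Grep α x
  set d := α/3 with hd
  set c : ℂ := -(y:ℂ) * Complex.exp (ω * Complex.I) with hc
  have hz : ∀ s : ℝ, -((y * s ^ (-d) : ℝ) : ℂ) * Complex.exp (ω * Complex.I) = ((s ^ (-d) : ℝ) : ℂ) * c := by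
    intro s; rw [hc]; push_cast; ring
  have a1 : HasDerivAt (fun s : ℝ => ((s ^ (μ - 1) : ℝ) : ℂ)) (((μ - 1) * t ^ (μ - 1 - 1) : ℝ) : ℂ) t :=
    (Real.hasDerivAt_rpow_const (Or.inl ht.ne')).ofReal_comp
  have a2 : HasDerivAt (fun s : ℝ => ((s ^ (-d) : ℝ) : ℂ) * c) ((((-d) * t ^ (-d - 1) : ℝ) : ℂ) * c) t :=
    (Real.hasDerivAt_rpow_const (Or.inl ht.ne')).ofReal_comp.mul_const c
  have a3 := (Wr_hasDerivAt d μ (by linarith) (by linarith) hμ (((t ^ (-d) : ℝ) : ℂ) * c)).comp t a2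
  have a4 := ((a1.mul a3).const_mul κ)
  have a5 : HasDerivAt (fun s : ℝ => (κ * (((s ^ (μ - 1) : ℝ) : ℂ) * Wr d μ (((s ^ (-d) : ℝ) : ℂ) * c))).re) _ t :=
    Complex.reCLM.hasFDerivAt.comp_hasDerivAt t a4
  have a6 := a5.congr_of_eventuallyEq (f₁ := fun s => Gfun α μ x s) (by
    filter_upwards [lt_mem_nhds ht] with s hs
    rw [h μ s hs, hz])
  refine a6.congr_deriv (Eq.symm ?_)
  rw [h _ t ht, hz, Complex.reCLM_apply]
  congr 2
  rw [← Wr_rec d μ (by linarith) (by linarith) hμ]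
  simp only [Function.comp]
  rw [Real.rpow_sub_one ht.ne' (μ - 1), Real.rpow_sub_one ht.ne' (-d)]
  push_cast
  ring

noncomputable def Afun (d t : ℝ) (κ c : ℂ) (m x : ℝ) : ℝ :=
  t ^ (m - 1) * (κ * Wr d m (c * ((x / t ^ d : ℝ) : ℂ))).re

lemma Afun_deriv (d t : ℝ) (κ c : ℂ) (m x : ℝ) (hd0 : 0 < d) (hd1 : d < 1/3) (hm : m < 1) (ht : 0 < t) :
    HasDerivAt (Afun d t κ c m) (Afun d t (κ * c) c (m - d) x) x := by
  have a0 : HasDerivAt (fun y : ℝ => y / t ^ d) (1 / t ^ d) x := (hasDerivAt_id x).div_const _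
  have a2 : HasDerivAt (fun y : ℝ => c * ((y / t ^ d : ℝ) : ℂ)) (c * ((1 / t ^ d : ℝ) : ℂ)) x :=
    a0.ofReal_comp.const_mul c
  have a3 := (Wr_hasDerivAt d m hd0 hd1 hm (c * ((x / t ^ d : ℝ) : ℂ))).comp x a2
  have a5 : HasDerivAt (fun y : ℝ => (κ * Wr d m (c * ((y / t ^ d : ℝ) : ℂ))).re) _ x :=
    Complex.reCLM.hasFDerivAt.comp_hasDerivAt x (a3.const_mul κ)
  have a6 : HasDerivAt (Afun d t κ c m) _ x := a5.const_mul (t ^ (m - 1))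
  refine a6.congr_deriv ?_
  unfold Afun
  rw [Complex.reCLM_apply, show m - d - 1 = (m - 1) - d by ring, Real.rpow_sub ht (m - 1) d]
  rw [show κ * (Wr d (m - d) (c * ((x / t ^ d : ℝ) : ℂ)) * (c * ((1 / t ^ d : ℝ) : ℂ))) =
    ((1 / t ^ d : ℝ) : ℂ) * (κ * c * Wr d (m - d) (c * ((x / t ^ d : ℝ) : ℂ))) by ring, Complex.re_ofReal_mul]
  ring

lemma Afun_zero (d t : ℝ) (κ c : ℂ) (m : ℝ) : Afun d t κ c m 0 = t ^ (m - 1) * ((Real.Gamma m)⁻¹ * κ.re) := by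
  unfold Afun
  rw [zero_div, Complex.ofReal_zero, mul_zero, Wr_zero, Complex.Gamma_ofReal, ← Complex.ofReal_inv,
    mul_comm κ, Complex.re_ofReal_mul]

noncomputable def pw (L R : ℝ → ℝ) (x : ℝ) : ℝ := if x < 0 then L x else R x

lemma Gfun_pw (α μ t x : ℝ) : Gfun α μ x t =
    pw (Afun (α/3) t ((1/3 : ℝ) : ℂ) 1 μ) (Afun (α/3) t (((-(2/3) : ℝ) : ℂ) * e23) e23 μ) x := by
  unfold Gfun pw Afun
  simp only [wright_eq, one_mul]
  split_ifs
  · rw [Complex.re_ofReal_mul]; ring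
  · rw [mul_assoc ((-(2/3) : ℝ) : ℂ), Complex.re_ofReal_mul]; ring

lemma pw_deriv (L R L1 R1 : ℝ → ℝ) (hL : ∀ x, HasDerivAt L (L1 x) x) (hR : ∀ x, HasDerivAt R (R1 x) x)
    (h0 : L 0 = R 0) (h1 : L1 0 = R1 0) (x : ℝ) : HasDerivAt (pw L R) (pw L1 R1 x) x := by
  rcases lt_trichotomy x 0 with h | h | h
  · have : pw L1 R1 x = L1 x := if_pos h
    rw [this]
    refine (hL x).congr_of_eventuallyEq ?_
    filter_upwards [gt_mem_nhds h] with y hy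
    exact if_pos hy
  · subst h
    have e : pw L1 R1 0 = R1 0 := if_neg (lt_irrefl _)
    rw [e]
    have l : HasDerivWithinAt (pw L R) (R1 0) (Iic 0) 0 := by
      rw [← h1]
      refine (hL 0).hasDerivWithinAt.congr (fun y hy => ?_) ?_
      · rcases eq_or_lt_of_le (show y ≤ 0 from hy) with h | h
        · rw [h, h0]; exact if_neg (lt_irrefl _)
        · exact if_pos h
      · rw [h0]; exact if_neg (lt_irrefl _)
    have r : HasDerivWithinAt (pw L R) (R1 0) (Ici 0) 0 := by
      refine (hR 0).hasDerivWithinAt.congr (fun y hy => ?_) ?_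
      · exact if_neg (not_lt.mpr hy)
      · exact if_neg (lt_irrefl _)
    have := l.union r
    rw [Iic_union_Ici] at this
    exact hasDerivWithinAt_univ.mp this
  · have : pw L1 R1 x = R1 x := if_neg (not_lt.mpr h.le)
    rw [this]
    refine (hR x).congr_of_eventuallyEq ?_
    filter_upwards [lt_mem_nhds h] with y hy
    exact if_neg (not_lt.mpr (le_of_lt hy))

lemma pw_cont (L R : ℝ → ℝ) (hL : Continuous L) (hR : Continuous R) (h0 : L 0 = R 0) : Continuous (pw L R) := by
  have : pw L R = fun x => if (0:ℝ) ≤ x then R x else L x := by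
    funext x
    unfold pw
    by_cases h : x < 0
    · rw [if_pos h, if_neg (not_le.mpr h)]
    · rw [if_neg h, if_pos (not_lt.mp h)]
  rw [this]
  refine Continuous.if_le hR hL continuous_const continuous_id ?_
  intro x hx
  rw [← hx, h0]

lemma conv_deriv (a b : ℝ) (hab : a < b) (g g1 τ : ℝ → ℝ) (hg : ∀ x, HasDerivAt g (g1 x) x) (hg1 : Continuous g1)
    (hτ : Continuous τ) (y : ℝ) :
    HasDerivAt (fun y => ∫ ξ in a..b, g (y - ξ) * τ ξ) (∫ ξ in a..b, g1 (y - ξ) * τ ξ) y := by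
  have hgc : Continuous g := continuous_iff_continuousAt.mpr fun x => (hg x).continuousAt
  obtain ⟨C, hC⟩ := (isCompact_Icc (a := y - 1 - b) (b := y + 1 - a)).exists_bound_of_continuousOn hg1.continuousOn
  have key := intervalIntegral.hasDerivAt_integral_of_dominated_loc_of_deriv_le (μ := volume) (a := a) (b := b)
    (F := fun y ξ => g (y - ξ) * τ ξ) (F' := fun y ξ => g1 (y - ξ) * τ ξ) (x₀ := y)
    (bound := fun ξ => C * |τ ξ|) (Metric.ball_mem_nhds y one_pos) ?_ ?_ ?_ ?_ ?_ ?_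
  · exact key.2
  · refine Eventually.of_forall fun x => Continuous.aestronglyMeasurable ?_
    exact (hgc.comp (by fun_prop)).mul hτ
  · apply Continuous.intervalIntegrable
    exact (hgc.comp (by fun_prop)).mul hτ
  · refine Continuous.aestronglyMeasurable ?_
    exact (hg1.comp (by fun_prop)).mul hτ
  · refine ae_of_all _ fun ξ hξ x hx => ?_
    rw [uIoc_of_le hab.le] at hξ
    rw [Metric.mem_ball, Real.dist_eq, abs_lt] at hx
    rw [norm_mul]
    refine mul_le_mul_of_nonneg_right (hC _ ⟨by linarith [hξ.2], by linarith [hξ.1]⟩) (norm_nonneg _)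
  · apply Continuous.intervalIntegrable
    fun_prop
  · refine ae_of_all _ fun ξ hξ x hx => ?_
    have := ((hg (x - ξ)).comp x ((hasDerivAt_id x).sub_const ξ)).mul_const (τ ξ)
    simpa using this

lemma space_part (α a b t x : ℝ) (h0 : 0 < α) (h1 : α < 1) (hab : a < b) (ht : 0 < t) (τ : ℝ → ℝ) (hτ : Continuous τ) :
    deriv (deriv (deriv (fun y => ∫ ξ in a..b, Gfun α (2*α/3) (y - ξ) t * τ ξ))) x =
      ∫ ξ in a..b, Gfun α (-α/3) (x - ξ) t * τ ξ := by
  set d := α/3 with hd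
  have hd0 : 0 < d := by linarith
  have hd1 : d < 1/3 := by linarith
  set κ : ℂ := ((1/3 : ℝ) : ℂ)
  set ρ : ℂ := ((-(2/3) : ℝ) : ℂ) with hρ
  have aL : ∀ (κ c : ℂ) (m : ℝ), m < 1 → ∀ x, HasDerivAt (Afun d t κ c m) (Afun d t (κ * c) c (m - d) x) x :=
    fun κ c m hm x => Afun_deriv d t κ c m x hd0 hd1 hm ht
  have aC : ∀ (κ c : ℂ) (m : ℝ), m < 1 → Continuous (Afun d t κ c m) :=
    fun κ c m hm => continuous_iff_continuousAt.mpr fun x => (aL κ c m hm x).continuousAt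
  have r1 : (ρ * e23).re = 1/3 := by rw [hρ, Complex.re_ofReal_mul, e23_re]; norm_num
  have r2 : (ρ * e23 * e23).re = 1/3 := by
    rw [hρ, mul_assoc, Complex.re_ofReal_mul, e23_eq]
    have : (√3 / 2) * (√3 / 2) = (3/4 : ℝ) := by
      have := Real.mul_self_sqrt (show (0:ℝ) ≤ 3 by norm_num)
      linarith
    simp only [Complex.mul_re, Complex.add_re, Complex.add_im, Complex.ofReal_re, Complex.ofReal_im, Complex.I_re,
      Complex.I_im, Complex.mul_im]
    linarith
  have q4 : ρ * e23 * e23 * e23 * e23 = ρ * e23 := by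
    linear_combination ρ * e23 * e23_cube
  have r4 : (ρ * e23 * e23 * e23 * e23).re = 1/3 := by rw [q4, r1]
  have k1 : κ.re = 1/3 := Complex.ofReal_re _
  set m0 := 2*α/3
  have hm0 : m0 = 2 * d := by simp only [m0, hd]; ring
  have hm2 : m0 - d - d = 0 := by rw [hm0]; ring
  set L0 := Afun d t κ 1 m0
  set L1 := Afun d t (κ * 1) 1 (m0 - d) with hL1
  set L2 := Afun d t (κ * 1 * 1) 1 (m0 - d - d) with hL2
  set L3 := Afun d t (κ * 1 * 1 * 1) 1 (m0 - d - d - d) with hL3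
  set R0 := Afun d t (ρ * e23) e23 m0
  set R1 := Afun d t (ρ * e23 * e23) e23 (m0 - d) with hR1
  set R2 := Afun d t (ρ * e23 * e23 * e23) e23 (m0 - d - d) with hR2
  set R3 := Afun d t (ρ * e23 * e23 * e23 * e23) e23 (m0 - d - d - d) with hR3
  have z0 : L0 0 = R0 0 := by simp only [L0, R0]; rw [Afun_zero, Afun_zero, r1, k1]
  have z1 : L1 0 = R1 0 := by simp only [L1, R1]; rw [Afun_zero, Afun_zero, r2, mul_one, k1]
  have z2 : L2 0 = R2 0 := by
    simp only [L2, R2]; rw [Afun_zero, Afun_zero, hm2, Real.Gamma_zero]; simp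
  have z3 : L3 0 = R3 0 := by simp only [L3, R3]; rw [Afun_zero, Afun_zero, r4, mul_one, mul_one, mul_one, k1]
  have l0 : m0 < 1 := by linarith
  have l1 : m0 - d < 1 := by linarith
  have l2 : m0 - d - d < 1 := by linarith
  have l3 : m0 - d - d - d < 1 := by linarith
  have d0 := pw_deriv L0 R0 L1 R1 (aL _ _ _ l0) (aL _ _ _ l0) z0 z1
  have d1 := pw_deriv L1 R1 L2 R2 (aL _ _ _ l1) (aL _ _ _ l1) z1 z2
  have d2 := pw_deriv L2 R2 L3 R3 (aL _ _ _ l2) (aL _ _ _ l2) z2 z3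
  have c1 := pw_cont L1 R1 (aC _ _ _ l1) (aC _ _ _ l1) z1
  have c2 := pw_cont L2 R2 (aC _ _ _ l2) (aC _ _ _ l2) z2
  have c3 := pw_cont L3 R3 (aC _ _ _ l3) (aC _ _ _ l3) z3
  have e0 : ∀ y, Gfun α m0 y t = pw L0 R0 y := fun y => Gfun_pw α m0 t y
  have e3 : ∀ y, Gfun α (-α/3) y t = pw L3 R3 y := by
    intro y
    rw [Gfun_pw, hL3, hR3, q4, mul_one, mul_one, mul_one, show m0 - d - d - d = -α/3 by rw [hm2, hd]; ring]
  simp_rw [e0, e3]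
  rw [funext fun y => (conv_deriv a b hab _ _ τ d0 c1 hτ y).deriv,
    funext fun y => (conv_deriv a b hab _ _ τ d1 c2 hτ y).deriv,
    (conv_deriv a b hab _ _ τ d2 c3 hτ x).deriv]

lemma time_J (α a b x s : ℝ) (h0 : 0 < α) (h1 : α < 1) (hab : a < b) (hs : 0 < s) (τ : ℝ → ℝ) (hτ : Continuous τ) :
    fracJ (1 - α) (fun r => ∫ ξ in a..b, Gfun α (2*α/3) (x - ξ) r * τ ξ) s =
      ∫ ξ in a..b, Gfun α (1 - α/3) (x - ξ) s * τ ξ := by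
  unfold fracJ
  obtain ⟨C, hC0, hC⟩ := Gbound α (2*α/3) h0 h1 (by linarith)
  have hm := G_meas α (2*α/3) h0 h1 (by linarith)
  have hb := beta_intg (2*α/3) (1-α) s (by linarith) (by linarith) hs
  have hΓ : Real.Gamma (1 - α) ≠ 0 := (Real.Gamma_pos_of_pos (by linarith)).ne'
  rw [intervalIntegral.integral_of_le hs.le, integral_Ioc_eq_integral_Ioo]
  simp_rw [intervalIntegral.integral_of_le hab.le, ← integral_mul_const]
  have hint : Integrable (Function.uncurry fun (r ξ : ℝ) => Gfun α (2*α/3) (x - ξ) r * τ ξ * (s - r) ^ (1 - α - 1))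
      ((volume.restrict (Ioo 0 s)).prod (volume.restrict (Ioc a b))) := by
    have hτi : Integrable (fun ξ => C * |τ ξ|) (volume.restrict (Ioc a b)) :=
      ((hτ.abs.const_mul C).integrableOn_Icc).mono_set Ioc_subset_Icc_self
    have hbi : Integrable (fun r : ℝ => r ^ (2*α/3 - 1) * (s - r) ^ (1 - α - 1)) (volume.restrict (Ioo 0 s)) := hb
    refine Integrable.mono' (hbi.mul_prod hτi) ?_ ?_
    · apply Measurable.aestronglyMeasurable
      refine Measurable.mul (Measurable.mul (hm.comp (by fun_prop : Measurable fun p : ℝ × ℝ => (x - p.2, p.1)))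
        (hτ.measurable.comp measurable_snd)) (by fun_prop)
    · rw [Measure.prod_restrict]
      refine (ae_restrict_iff' (measurableSet_Ioo.prod measurableSet_Ioc)).mpr (ae_of_all _ fun p hp => ?_)
      have p1 := hp.1.1
      have p2 : 0 < s - p.1 := by linarith [hp.1.2]
      simp only [Function.uncurry]
      rw [norm_mul, norm_mul, Real.norm_eq_abs, Real.norm_eq_abs, Real.norm_of_nonneg (by positivity)]
      have := hC (x - p.2) p.1 p1
      calc _ ≤ C * p.1 ^ (2*α/3 - 1) * |τ p.2| * (s - p.1) ^ (1 - α - 1) := by gcongr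
        _ = _ := by ring
  rw [integral_integral_swap hint, ← integral_const_mul]
  refine integral_congr_ae (ae_restrict_of_ae ?_)
  filter_upwards [(measure_singleton x : volume ({x} : Set ℝ) = 0) |> compl_mem_ae_iff.mpr] with ξ hξ
  have hne : x - ξ ≠ 0 := fun h => hξ (by simp only [mem_singleton_iff]; linarith)
  have := G_J α (x - ξ) s h0 h1 hne hs
  simp_rw [mul_right_comm _ (τ ξ)]
  rw [integral_mul_const, this]
  field_simp

lemma time_part (α a b x t : ℝ) (h0 : 0 < α) (h1 : α < 1) (hab : a < b) (ht : 0 < t) (τ : ℝ → ℝ) (hτ : Continuous τ) :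
    deriv (fun s => fracJ (1 - α) (fun r => ∫ ξ in a..b, Gfun α (2*α/3) (x - ξ) r * τ ξ) s) t =
      ∫ ξ in a..b, Gfun α (-α/3) (x - ξ) t * τ ξ := by
  have hev : (fun s => fracJ (1 - α) (fun r => ∫ ξ in a..b, Gfun α (2*α/3) (x - ξ) r * τ ξ) s) =ᶠ[𝓝 t]
      fun s => ∫ ξ in a..b, Gfun α (1 - α/3) (x - ξ) s * τ ξ := by
    filter_upwards [lt_mem_nhds ht] with s hs
    exact time_J α a b x s h0 h1 hab hs τ hτ
  rw [hev.deriv_eq]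
  obtain ⟨C, hC0, hC⟩ := Gbound α (-α/3) h0 h1 (by linarith)
  obtain ⟨C1, hC10, hC1⟩ := Gbound α (1-α/3) h0 h1 (by linarith)
  have hm := G_meas α (1-α/3) h0 h1 (by linarith)
  have hm' := G_meas α (-α/3) h0 h1 (by linarith)
  have ms : ∀ s, Measurable (fun ξ : ℝ => Gfun α (1-α/3) (x - ξ) s * τ ξ) := fun s =>
    (hm.comp (by fun_prop : Measurable fun ξ : ℝ => (x - ξ, s))).mul hτ.measurable
  have ms' : ∀ s, Measurable (fun ξ : ℝ => Gfun α (-α/3) (x - ξ) s * τ ξ) := fun s =>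
    (hm'.comp (by fun_prop : Measurable fun ξ : ℝ => (x - ξ, s))).mul hτ.measurable
  have key := intervalIntegral.hasDerivAt_integral_of_dominated_loc_of_deriv_le (μ := volume) (a := a) (b := b)
    (F := fun s ξ => Gfun α (1-α/3) (x - ξ) s * τ ξ) (F' := fun s ξ => Gfun α (-α/3) (x - ξ) s * τ ξ) (x₀ := t)
    (bound := fun ξ => C * (t/2) ^ (-α/3 - 1) * |τ ξ|) (Ioi_mem_nhds (show t/2 < t by linarith)) ?_ ?_ ?_ ?_ ?_ ?_
  · exact key.2.deriv
  · exact Eventually.of_forall fun s => (ms s).aestronglyMeasurable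
  · have : IntervalIntegrable (fun ξ => C1 * t ^ (1-α/3 - 1) * |τ ξ|) volume a b := by
      apply Continuous.intervalIntegrable; fun_prop
    refine this.mono_fun' (ms t).aestronglyMeasurable (ae_of_all _ fun ξ => ?_)
    beta_reduce
    rw [norm_mul, Real.norm_eq_abs, Real.norm_eq_abs]
    exact mul_le_mul_of_nonneg_right (hC1 _ t ht) (abs_nonneg _)
  · exact (ms' t).aestronglyMeasurable
  · refine ae_of_all _ fun ξ hξ s hs => ?_
    have hs' : t/2 < s := hs
    rw [norm_mul, Real.norm_eq_abs, Real.norm_eq_abs]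
    refine mul_le_mul_of_nonneg_right ((hC _ s (by linarith)).trans ?_) (abs_nonneg _)
    refine mul_le_mul_of_nonneg_left ?_ hC0
    exact Real.rpow_le_rpow_of_nonpos (by linarith) hs'.le (by linarith)
  · apply Continuous.intervalIntegrable; fun_prop
  · refine ae_of_all _ fun ξ hξ s hs => ?_
    have hs' : t/2 < s := hs
    have := (G_t α (1-α/3) (x - ξ) s h0 h1 (by linarith) (by linarith)).mul_const (τ ξ)
    rw [show 1 - α/3 - 1 = -α/3 by ring] at this
    exact this

theorem potential_w5_solves_equation
    (α : ℝ) (hα0 : 0 < α) (hα1 : α < 1) (a b : ℝ) (hab : a < b)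
    (τ₅ : ℝ → ℝ) (hτ₅ : ContinuousOn τ₅ (Set.Icc a b))
    (w₅ : ℝ → ℝ → ℝ)
    (hw₅ : ∀ x t, w₅ x t = ∫ ξ in a..b, Ghat α (2*α/3) (x - ξ) t * τ₅ ξ) :
    ∀ (x t : ℝ), 0 < t →
      deriv (fun s => fracJ (1 - α) (fun r => w₅ x r) s) t =
        ∫ ξ in a..b, Ghat α (-α/3) (x - ξ) t * τ₅ ξ ∧
      deriv (deriv (deriv (fun y => w₅ y t))) x =
        ∫ ξ in a..b, Ghat α (-α/3) (x - ξ) t * τ₅ ξ := by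
  intro x t ht
  set τ : ℝ → ℝ := IccExtend hab.le ((Icc a b).domRestrict τ₅) with hτd
  have hτ : Continuous τ := (continuousOn_iff_continuous_domRestrict.mp hτ₅).Icc_extend'
  have e : ∀ μ y s : ℝ, ∫ ξ in a..b, Ghat α μ (y - ξ) s * τ₅ ξ = ∫ ξ in a..b, Gfun α μ (y - ξ) s * τ ξ := by
    intro μ y s
    refine intervalIntegral.integral_congr fun ξ hξ => ?_
    rw [uIcc_of_le hab.le] at hξ
    simp only [Ghat_eq]
    rw [hτd, IccExtend_of_mem _ _ hξ, domRestrict_apply]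
  simp_rw [hw₅, e]
  exact ⟨time_part α a b x t hα0 hα1 hab ht τ hτ, space_part α a b t x hα0 hα1 hab ht τ hτ⟩
end

section
/- Let 0<α<1, a<b, and let τ₅ ∈ C([a,b]). Define w₅(x,t)=∫_a^b G_α^{2α/3}(x−ξ,t)τ₅(ξ)dξ. Then for every x with a<x<b, the fractional integral of order 1−α of w₅ in t tends to τ₅(x) as t→0⁺: lim_{t→0⁺} J^{1−α}_{0,t} w₅(x,·)(t) = τ₅(x). -/
open MeasureTheory Real Filter Set Topology

lemma gint_diff (s : ℝ) (hs : 0 < s) (w : ℂ) (hw : 0 < w.re) :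
    DifferentiableAt ℂ (fun w : ℂ => ∫ u in Ioi (0:ℝ), ((u ^ (s-1) : ℝ) : ℂ) * Complex.exp (-w * u)) w := by
  have hm : ∀ (p : ℝ) (z : ℂ), AEStronglyMeasurable (fun u : ℝ => ((u ^ p : ℝ) : ℂ) * Complex.exp (-z * u))
      (volume.restrict (Ioi 0)) := by
    intro p z
    apply Measurable.aestronglyMeasurable
    fun_prop
  have hn : ∀ (p u : ℝ) (z : ℂ), 0 < u → ‖((u ^ p : ℝ) : ℂ) * Complex.exp (-z * u)‖ = u ^ p * rexp (- z.re * u) := by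
    intro p u z hu
    rw [norm_mul, Complex.norm_real, Complex.norm_exp, Real.norm_of_nonneg (by positivity)]
    simp
  have hi : ∀ (p k : ℝ), -1 < p → 0 < k → IntegrableOn (fun u : ℝ => u ^ p * rexp (-k * u)) (Ioi 0) := by
    intro p k hp hk
    have := integrableOn_rpow_mul_exp_neg_mul_rpow (p := 1) (s := p) (b := k) hp one_pos hk
    simpa using this
  have h := hasDerivAt_integral_of_dominated_loc_of_deriv_le (𝕜 := ℂ) (μ := volume.restrict (Ioi (0:ℝ)))
    (F := fun (w : ℂ) (u : ℝ) => ((u ^ (s-1) : ℝ) : ℂ) * Complex.exp (-w * u))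
    (F' := fun (w : ℂ) (u : ℝ) => -(((u ^ s : ℝ) : ℂ) * Complex.exp (-w * u)))
    (x₀ := w) (s := {z : ℂ | w.re / 2 < z.re}) (bound := fun u => u ^ s * rexp (-(w.re/2) * u))
    ?_ ?_ ?_ ?_ ?_ ?_ ?_
  · exact h.2.differentiableAt
  · exact (isOpen_lt continuous_const Complex.continuous_re).mem_nhds (by simp; linarith)
  · exact Eventually.of_forall fun z => hm _ _
  · refine Integrable.mono' (hi (s-1) w.re (by linarith) hw) (hm _ _) ?_
    filter_upwards [ae_restrict_mem measurableSet_Ioi] with u hu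
    rw [hn _ _ _ hu]
  · exact (hm _ _).neg
  · filter_upwards [ae_restrict_mem measurableSet_Ioi] with u hu z hz
    rw [norm_neg, hn _ _ _ hu]
    have hu' : (0:ℝ) < u := hu
    have : w.re / 2 < z.re := hz
    gcongr
  · exact hi _ _ (by linarith) (by linarith)
  · filter_upwards [ae_restrict_mem measurableSet_Ioi] with u hu z hz
    have hu' : (0:ℝ) < u := hu
    have h1 : HasDerivAt (fun w : ℂ => -w * u) (-1 * u) z := ((hasDerivAt_id z).neg).mul_const _
    have h2 := (h1.cexp).const_mul ((u ^ (s-1) : ℝ) : ℂ)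
    convert! h2 using 1
    have : u ^ s = u ^ (s-1) * u := by
      rw [Real.rpow_sub_one hu'.ne']; field_simp
    rw [this]; push_cast; ring

lemma gint (s : ℝ) (hs : 0 < s) (w : ℂ) (hw : 0 < w.re) :
    ∫ u in Ioi (0:ℝ), ((u ^ (s-1) : ℝ) : ℂ) * Complex.exp (-w * u) =
      w ^ (-(s:ℂ)) * Complex.Gamma s := by
  have hU : IsOpen {z : ℂ | 0 < z.re} := isOpen_lt continuous_const Complex.continuous_re
  have hf : AnalyticOnNhd ℂ (fun w : ℂ => ∫ u in Ioi (0:ℝ), ((u ^ (s-1) : ℝ) : ℂ) * Complex.exp (-w * u))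
      {z : ℂ | 0 < z.re} := by
    apply DifferentiableOn.analyticOnNhd _ hU
    intro z hz
    exact (gint_diff s hs z hz).differentiableWithinAt
  have hg : AnalyticOnNhd ℂ (fun w : ℂ => w ^ (-(s:ℂ)) * Complex.Gamma s) {z : ℂ | 0 < z.re} := by
    apply DifferentiableOn.analyticOnNhd _ hU
    intro z hz
    have hz' : z ∈ Complex.slitPlane := Or.inl hz
    exact ((differentiableAt_id.cpow_const hz').mul_const _).differentiableWithinAt
  have hc : IsPreconnected {z : ℂ | 0 < z.re} := (convex_halfSpace_re_gt 0).isPreconnected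
  refine hf.eqOn_of_preconnected_of_frequently_eq hg hc (z₀ := 1) (by simp) ?_ hw
  have hreal : ∀ r : ℝ, 0 < r → ∫ u in Ioi (0:ℝ), ((u ^ (s-1) : ℝ) : ℂ) * Complex.exp (-(r:ℂ) * u) =
      (r:ℂ) ^ (-(s:ℂ)) * Complex.Gamma s := by
    intro r hr
    have := Complex.integral_cpow_mul_exp_neg_mul_Ioi (a := s) (r := r) (by simpa using hs) hr
    rw [one_div, Complex.inv_cpow _ _ (by rw [Complex.arg_ofReal_of_nonneg hr.le]; exact pi_pos.ne), ← Complex.cpow_neg] at this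
    rw [← this]
    refine setIntegral_congr_fun measurableSet_Ioi fun u hu => ?_
    rw [Complex.ofReal_cpow (le_of_lt hu)]
    push_cast
    ring_nf
  have ht : Tendsto (fun n : ℕ => (((1 + 1 / ((n:ℝ) + 1) : ℝ)) : ℂ)) atTop (𝓝[≠] 1) := by
    rw [tendsto_nhdsWithin_iff]
    constructor
    · have := (tendsto_one_div_add_atTop_nhds_zero_nat (𝕜 := ℝ)).const_add 1
      have h2 := (Complex.continuous_ofReal.tendsto _).comp this
      simp only [add_zero, Complex.ofReal_one] at h2
      exact h2
    · refine Eventually.of_forall fun n => ?_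
      have : (0:ℝ) < 1 / ((n:ℝ)+1) := by positivity
      simp only [mem_compl_iff, mem_singleton_iff]
      intro h
      have : (1 + 1 / ((n:ℝ)+1)) = 1 := by exact_mod_cast h
      linarith
  refine ht.frequently (Eventually.frequently (Eventually.of_forall fun n => ?_))
  exact hreal _ (by positivity)

lemma rpow_lin (ν C k : ℝ) (hν0 : 0 < ν) (hν1 : ν < 1) (hC : 0 ≤ C) (hk : 0 < k) :
    ∃ D, ∀ u : ℝ, 0 < u → C * u ^ ν ≤ D + k * u := by
  have h1 : Tendsto (fun B : ℝ => C * B ^ (-(1-ν))) atTop (𝓝 (C * 0)) :=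
    (tendsto_rpow_neg_atTop (by linarith)).const_mul C
  rw [mul_zero] at h1
  obtain ⟨B, hB, hB0⟩ := ((h1.eventually (gt_mem_nhds hk)).and (eventually_gt_atTop 0)).exists
  refine ⟨C * B ^ ν, fun u hu => ?_⟩
  rcases le_total u B with h | h
  · have : u ^ ν ≤ B ^ ν := by gcongr
    have := mul_le_mul_of_nonneg_left this hC
    nlinarith [mul_pos hk hu]
  · have h2 : u ^ ν = u ^ (-(1-ν)) * u := by
      rw [← Real.rpow_add_one hu.ne']; ring_nf
    have h3 : u ^ (-(1-ν)) ≤ B ^ (-(1-ν)) := Real.rpow_le_rpow_of_nonpos hB0 h (by linarith)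
    have h4 : C * u ^ (-(1-ν)) ≤ k := (mul_le_mul_of_nonneg_left h3 hC).trans hB.le
    have h5 : 0 ≤ C * B ^ ν := by positivity
    rw [h2]
    nlinarith [mul_le_mul_of_nonneg_right h4 hu.le]

noncomputable def FF (ν μ : ℝ) (w c : ℂ) (u : ℝ) : ℂ :=
  ((u ^ (-μ) : ℝ) : ℂ) * Complex.exp (-w * u) * Complex.exp (c * ((u ^ ν : ℝ) : ℂ))

lemma FF_sum (ν μ : ℝ) (hν0 : 0 < ν) (hν1 : ν < 1) (hμ : μ < 1) (w c : ℂ) (hw : 0 < w.re) :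
    HasSum (fun n : ℕ => c ^ n / n.factorial *
      (w ^ (-((1 - μ + ν * n : ℝ) : ℂ)) * Complex.Gamma ((1 - μ + ν * n : ℝ) : ℂ)))
      (∫ u in Ioi (0:ℝ), FF ν μ w c u) := by
  have hsum := hasSum_integral_of_dominated_convergence (μ := volume.restrict (Ioi (0:ℝ)))
    (F := fun (n : ℕ) (u : ℝ) => c ^ n / n.factorial * (((u ^ ((1 - μ + ν * n) - 1) : ℝ) : ℂ) * Complex.exp (-w * u)))
    (f := FF ν μ w c)
    (fun n u => (‖c‖ * u ^ ν) ^ n / n.factorial * (u ^ (-μ) * rexp (-w.re * u))) ?_ ?_ ?_ ?_ ?_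
  · convert! hsum using 2 with n
    rw [integral_const_mul, gint _ _ _ hw]
    have : 0 ≤ ν * n := by positivity
    linarith
  · intro n
    apply Measurable.aestronglyMeasurable
    fun_prop
  · intro n
    filter_upwards [ae_restrict_mem measurableSet_Ioi] with u hu
    have hu' : (0:ℝ) < u := hu
    apply le_of_eq
    rw [norm_mul, norm_mul, Complex.norm_real, Complex.norm_exp, Real.norm_of_nonneg (by positivity), norm_div, norm_pow, mul_pow,
      ← Real.rpow_natCast (u ^ ν), ← Real.rpow_mul hu'.le]
    have : u ^ ((1 - μ + ν * n) - 1) = u ^ (ν * n) * u ^ (-μ) := by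
      rw [← Real.rpow_add hu']; ring_nf
    rw [this]
    simp
    ring
  · filter_upwards with u
    exact (Real.summable_pow_div_factorial _).mul_right _
  · have : (fun u : ℝ => ∑' n : ℕ, (‖c‖ * u ^ ν) ^ n / n.factorial * (u ^ (-μ) * rexp (-w.re * u)))
       = fun u => rexp (‖c‖ * u ^ ν) * (u ^ (-μ) * rexp (-w.re * u)) := by
      ext u
      rw [tsum_mul_right, Real.exp_eq_exp_ℝ, (NormedSpace.expSeries_div_hasSum_exp (‖c‖ * u ^ ν)).tsum_eq]
    rw [this]
    obtain ⟨D, hD⟩ := rpow_lin ν ‖c‖ (w.re / 2) hν0 hν1 (norm_nonneg _) (by linarith)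
    have hi := (integrableOn_rpow_mul_exp_neg_mul_rpow (p := 1) (s := -μ) (b := w.re/2) (by linarith) one_pos (by linarith)).const_mul (rexp D)
    refine Integrable.mono' hi ?_ ?_
    · apply Measurable.aestronglyMeasurable
      fun_prop
    · filter_upwards [ae_restrict_mem measurableSet_Ioi] with u hu
      have hu' : (0:ℝ) < u := hu
      rw [Real.norm_of_nonneg (by positivity), Real.rpow_one]
      calc rexp (‖c‖ * u ^ ν) * (u ^ (-μ) * rexp (-w.re * u)) = u ^ (-μ) * rexp (‖c‖ * u ^ ν + -w.re * u) := by
            rw [Real.exp_add]; ring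
        _ ≤ u ^ (-μ) * rexp (D + -(w.re/2) * u) := by
            have := hD u hu'
            gcongr u ^ (-μ) * rexp ?_
            linarith
        _ = _ := by rw [Real.exp_add]; ring
  · filter_upwards [ae_restrict_mem measurableSet_Ioi] with u hu
    have hu' : (0:ℝ) < u := hu
    have h := (NormedSpace.expSeries_div_hasSum_exp (c * ((u ^ ν : ℝ) : ℂ))).mul_right (((u ^ (-μ) : ℝ) : ℂ) * Complex.exp (-w * u))
    rw [← Complex.exp_eq_exp_ℂ] at h
    convert! h using 1
    · ext n
      have : u ^ ((1 - μ + ν * n) - 1) = (u ^ ν) ^ n * u ^ (-μ) := by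
        rw [← Real.rpow_natCast (u ^ ν), ← Real.rpow_mul hu'.le, ← Real.rpow_add hu']; ring_nf
      rw [this]
      push_cast
      ring
    · simp only [FF]; ring

lemma FF_fub (ν μ : ℝ) (hν0 : 0 < ν) (hμ : μ + ν < 1) (w c : ℂ) (hw : 0 < w.re) (hc : c.re < 0) :
    IntegrableOn (fun y : ℝ => ∫ u in Ioi (0:ℝ), FF ν μ w (c * y) u) (Ioi 0) ∧
    ∫ y in Ioi (0:ℝ), ∫ u in Ioi (0:ℝ), FF ν μ w (c * y) u =
      -(1/c) * (w ^ (-((1 - μ - ν : ℝ) : ℂ)) * Complex.Gamma ((1 - μ - ν : ℝ) : ℂ)) := by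
  have hre : ∀ u : ℝ, 0 < u → (c * ((u ^ ν : ℝ) : ℂ)).re < 0 := by
    intro u hu
    rw [Complex.re_mul_ofReal]
    exact mul_neg_of_neg_of_pos hc (by positivity)
  have hF : ∀ y u : ℝ, FF ν μ w (c * y) u = ((u ^ (-μ) : ℝ) : ℂ) * Complex.exp (-w * u) * Complex.exp ((c * ((u ^ ν : ℝ) : ℂ)) * y) := by
    intro y u
    simp only [FF]
    ring_nf
  have hint : Integrable (Function.uncurry fun y u : ℝ => FF ν μ w (c * y) u)
      ((volume.restrict (Ioi (0:ℝ))).prod (volume.restrict (Ioi (0:ℝ)))) := by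
    rw [integrable_prod_iff']
    · constructor
      · filter_upwards [ae_restrict_mem measurableSet_Ioi] with u hu
        simp only [Function.uncurry, hF]
        exact (integrableOn_exp_mul_complex_Ioi (hre u hu) 0).const_mul _
      · have hi := (integrableOn_rpow_mul_exp_neg_mul_rpow (p := 1) (s := -μ-ν) (b := w.re) (by linarith) one_pos hw).mul_const (1 / (-c.re))
        refine hi.congr ?_
        filter_upwards [ae_restrict_mem measurableSet_Ioi] with u hu
        have hu' : (0:ℝ) < u := hu
        have : ∀ y : ℝ, ‖Function.uncurry (fun y u : ℝ => FF ν μ w (c * y) u) (y, u)‖ = (u ^ (-μ) * rexp (-w.re * u)) * rexp ((c.re * u ^ ν) * y) := by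
          intro y
          simp only [Function.uncurry, hF]
          rw [norm_mul, norm_mul, Complex.norm_real, Complex.norm_exp, Complex.norm_exp, Real.norm_of_nonneg (by positivity)]
          rw [Complex.re_mul_ofReal, Complex.re_mul_ofReal, Complex.re_mul_ofReal, Complex.neg_re]
        simp only [this]
        rw [integral_const_mul, integral_exp_mul_Ioi (mul_neg_of_neg_of_pos hc (by positivity)), Real.rpow_one, Real.rpow_sub hu']
        have h0 : c.re ≠ 0 := hc.ne
        have h1 : u ^ ν ≠ 0 := by positivity
        simp
        field_simp
    · apply Measurable.aestronglyMeasurable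
      simp only [FF]
      fun_prop
  refine ⟨hint.integral_prod_left, ?_⟩
  rw [integral_integral_swap hint, ← gint _ (by linarith) _ hw, ← integral_const_mul]
  refine setIntegral_congr_fun measurableSet_Ioi fun u hu => ?_
  have hu' : (0:ℝ) < u := hu
  simp only [hF]
  have h0 : c ≠ 0 := by rintro rfl; simp at hc
  have h1 : ((u ^ ν : ℝ) : ℂ) ≠ 0 := by
    have : u ^ ν ≠ 0 := by positivity
    exact_mod_cast this
  rw [integral_const_mul, integral_exp_mul_complex_Ioi (hre u hu)]
  have : u ^ (1 - μ - ν - 1) = u ^ (-μ) / u ^ ν := by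
    rw [← Real.rpow_sub hu']; ring_nf
  rw [this]
  push_cast
  simp
  field_simp

lemma inv_Gamma_refl (σ : ℂ) (h : σ.re < 1) :
    1 / Complex.Gamma σ = Complex.Gamma (1 - σ) * Complex.sin (π * σ) / π := by
  have h1 : Complex.Gamma (1 - σ) ≠ 0 := Complex.Gamma_ne_zero_of_re_pos (by simp; linarith)
  have h2 := Complex.Gamma_mul_Gamma_one_sub σ
  have hpi : (π : ℂ) ≠ 0 := by exact_mod_cast pi_ne_zero
  by_cases hs : Complex.sin (π * σ) = 0
  · rw [hs, div_zero] at h2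
    have := (mul_eq_zero.mp h2).resolve_right h1
    rw [hs, this]; simp
  · have h3 : Complex.Gamma σ ≠ 0 := by
      intro h0
      rw [h0, zero_mul] at h2
      exact (div_ne_zero hpi hs) h2.symm
    rw [eq_div_iff hs] at h2
    rw [div_eq_div_iff h3 hpi]
    linear_combination -h2

lemma expI_cpow (ψ : ℝ) (h1 : -π < ψ) (h2 : ψ ≤ π) (s : ℂ) :
    (Complex.exp (ψ * Complex.I)) ^ s = Complex.exp (ψ * Complex.I * s) := by
  rw [Complex.cpow_def_of_ne_zero (Complex.exp_ne_zero _), Complex.log_exp (by simpa using h1) (by simpa using h2)]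

lemma wright_rep_s9 (ν μ ψ : ℝ) (hν0 : 0 < ν) (hν1 : ν < 1) (hμ : μ < 1) (hψ : |ψ| < π / 2) (z : ℂ) :
    wrightPhi (-(ν:ℂ)) μ z = (1 / (2 * π * Complex.I)) *
      (Complex.exp (π * μ * Complex.I) * Complex.exp (ψ * Complex.I * (1 - μ)) *
        (∫ u in Ioi (0:ℝ), FF ν μ (Complex.exp (ψ * Complex.I)) (z * (Complex.exp (-(π * ν * Complex.I)) * Complex.exp (ψ * Complex.I * ν))) u)
      - Complex.exp (-(π * μ * Complex.I)) *
        (∫ u in Ioi (0:ℝ), FF ν μ 1 (z * Complex.exp (π * ν * Complex.I)) u)) := by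
  rw [abs_lt] at hψ
  have hpp := pi_pos
  have hw : 0 < (Complex.exp (ψ * Complex.I)).re := by
    rw [Complex.exp_ofReal_mul_I_re]
    exact Real.cos_pos_of_mem_Ioo ⟨by linarith, by linarith⟩
  have S1 := FF_sum ν μ hν0 hν1 hμ (Complex.exp (ψ * Complex.I)) (z * (Complex.exp (-(π * ν * Complex.I)) * Complex.exp (ψ * Complex.I * ν))) hw
  have S2 := FF_sum ν μ hν0 hν1 hμ 1 (z * Complex.exp (π * ν * Complex.I)) (by simp)
  have S := ((S1.mul_left (Complex.exp (π * μ * Complex.I) * Complex.exp (ψ * Complex.I * (1 - μ)))).sub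
    (S2.mul_left (Complex.exp (-(π * μ * Complex.I))))).mul_left (1 / (2 * π * Complex.I))
  rw [← S.tsum_eq, wrightPhi]
  congr 1
  ext n
  have hre : (-(ν:ℂ) * n + μ).re < 1 := by
    have : 0 ≤ ν * n := by positivity
    simp
    linarith
  have hG : Complex.Gamma ((1 - μ + ν * n : ℝ) : ℂ) = Complex.Gamma (1 - (-(ν:ℂ) * n + μ)) := by
    congr 1; push_cast; ring
  have e1 : z ^ n / ((n.factorial : ℂ) * Complex.Gamma (-(ν:ℂ) * n + μ)) =
      z ^ n / (n.factorial : ℂ) * (1 / Complex.Gamma (-(ν:ℂ) * n + μ)) := by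
    rw [div_mul_div_comm, mul_one]
  rw [e1, inv_Gamma_refl _ hre, hG, expI_cpow ψ (by linarith) (by linarith), Complex.one_cpow, mul_pow, mul_pow, mul_pow,
    ← Complex.exp_nat_mul, ← Complex.exp_nat_mul, ← Complex.exp_nat_mul, Complex.sin]
  have e2 : Complex.exp (π * μ * Complex.I) * Complex.exp (ψ * Complex.I * (1 - μ)) * (Complex.exp (n * (-(π * ν * Complex.I))) * Complex.exp (n * (ψ * Complex.I * ν)))
      * Complex.exp (ψ * Complex.I * (-((1 - μ + ν * n : ℝ) : ℂ))) = Complex.exp (π * (-(ν:ℂ) * n + μ) * Complex.I) := by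
    simp only [← Complex.exp_add]
    congr 1; push_cast; ring
  have e3 : Complex.exp (-(π * μ * Complex.I)) * Complex.exp (n * (π * ν * Complex.I)) = Complex.exp (-(π * (-(ν:ℂ) * n + μ)) * Complex.I) := by
    simp only [← Complex.exp_add]
    congr 1; ring
  rw [← e2, ← e3]
  have hpi : (π : ℂ) ≠ 0 := by exact_mod_cast pi_ne_zero
  have hf : (n.factorial : ℂ) ≠ 0 := by exact_mod_cast n.factorial_ne_zero
  have hI : (1:ℂ) / (2 * π * Complex.I) = -Complex.I / (2 * π) := by
    rw [div_eq_div_iff (by simp [hpi]) (by simp [hpi])]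
    linear_combination (2 * π : ℂ) * Complex.I_sq
  rw [hI]
  ring

lemma wright_ray (α θ : ℝ) (hα0 : 0 < α) (hα1 : α < 1)
    (h1 : Real.cos (θ - π * (α/3) + π * α / 2 * (α / 3)) < 0) (h2 : Real.cos (θ + π * (α/3)) < 0) :
    IntegrableOn (fun y : ℝ => wrightPhi (-(α/3)) ((2*α/3 : ℝ) : ℂ) (Complex.exp (θ * Complex.I) * y)) (Ioi 0) ∧
    ∫ y in Ioi (0:ℝ), wrightPhi (-(α/3)) ((2*α/3 : ℝ) : ℂ) (Complex.exp (θ * Complex.I) * y) =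
      - (Complex.exp (-(θ * Complex.I)) * ((1 / Real.Gamma α : ℝ) : ℂ)) := by
  set ν : ℝ := α / 3 with hν
  set μ : ℝ := 2 * α / 3 with hμ
  set ψ : ℝ := π * α / 2 with hψ
  have hpp := pi_pos
  have hψ0 : 0 < ψ := by positivity
  have hψ1 : ψ < π / 2 := by rw [hψ]; nlinarith
  have hw : 0 < (Complex.exp (ψ * Complex.I)).re := by
    rw [Complex.exp_ofReal_mul_I_re]
    exact Real.cos_pos_of_mem_Ioo ⟨by linarith, by linarith⟩
  set ζ := Complex.exp (θ * Complex.I) with hζ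
  set c1 := ζ * (Complex.exp (-(π * ν * Complex.I)) * Complex.exp (ψ * Complex.I * ν)) with hc1
  set c2 := ζ * Complex.exp (π * ν * Complex.I) with hc2
  have hc1e : c1 = Complex.exp (((θ - π * ν + ψ * ν : ℝ) : ℂ) * Complex.I) := by
    rw [hc1, hζ, ← Complex.exp_add, ← Complex.exp_add]; congr 1; push_cast; ring
  have hc2e : c2 = Complex.exp (((θ + π * ν : ℝ) : ℂ) * Complex.I) := by
    rw [hc2, hζ, ← Complex.exp_add]; congr 1; push_cast; ring
  have hr1 : c1.re < 0 := by rw [hc1e, Complex.exp_ofReal_mul_I_re]; exact h1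
  have hr2 : c2.re < 0 := by rw [hc2e, Complex.exp_ofReal_mul_I_re]; exact h2
  obtain ⟨I1, V1⟩ := FF_fub ν μ (by linarith) (by linarith) (Complex.exp (ψ * Complex.I)) c1 hw hr1
  obtain ⟨I2, V2⟩ := FF_fub ν μ (by linarith) (by linarith) 1 c2 (by simp) hr2
  have hfun : (fun y : ℝ => wrightPhi (-(α/3)) ((μ : ℝ) : ℂ) (ζ * y)) = fun y : ℝ =>
      (1 / (2 * π * Complex.I)) *
      (Complex.exp (π * μ * Complex.I) * Complex.exp (ψ * Complex.I * (1 - μ)) *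
        (∫ u in Ioi (0:ℝ), FF ν μ (Complex.exp (ψ * Complex.I)) (c1 * y) u)
      - Complex.exp (-(π * μ * Complex.I)) *
        (∫ u in Ioi (0:ℝ), FF ν μ 1 (c2 * y) u)) := by
    ext y
    have := wright_rep_s9 ν μ ψ (by linarith) (by linarith) (by linarith) (abs_lt.mpr ⟨by linarith, hψ1⟩) (ζ * y)
    have hcast : (-(α/3) : ℂ) = -(ν : ℂ) := by rw [hν]; push_cast; ring
    rw [hcast, this, hc1, hc2]
    simp only [mul_right_comm ζ (y:ℂ)]
  rw [hfun]
  have J1 := I1.const_mul (Complex.exp (π * μ * Complex.I) * Complex.exp (ψ * Complex.I * (1 - μ)))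
  have J2 := I2.const_mul (Complex.exp (-(π * μ * Complex.I)))
  refine ⟨(J1.sub J2).const_mul _, ?_⟩
  rw [integral_const_mul, integral_sub J1 J2, integral_const_mul, integral_const_mul, V1, V2]
  have h1mu : (1 - μ - ν : ℝ) = 1 - α := by rw [hν, hμ]; ring
  rw [h1mu, expI_cpow ψ (by linarith) (by linarith), Complex.one_cpow]
  have hgam : ((1 / Real.Gamma α : ℝ) : ℂ) = Complex.Gamma ((1 - α : ℝ) : ℂ) * Complex.sin (π * α) / π := by
    rw [Complex.ofReal_div, ← Complex.Gamma_ofReal, Complex.ofReal_one, inv_Gamma_refl _ (by simpa using hα1)]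
    push_cast; rfl
  rw [hgam, hc1e, hc2e, one_div (Complex.exp _), one_div (Complex.exp _), ← Complex.exp_neg, ← Complex.exp_neg, Complex.sin]
  have e1 : Complex.exp (-(θ * Complex.I)) * Complex.exp (π * α * Complex.I) = Complex.exp (π * μ * Complex.I) * Complex.exp (ψ * Complex.I * (1 - μ)) *
     (Complex.exp (-(((θ - π * ν + ψ * ν : ℝ) : ℂ) * Complex.I)) * Complex.exp (ψ * Complex.I * (-((1 - α : ℝ) : ℂ)))) := by
    simp only [← Complex.exp_add]
    congr 1; rw [hν, hμ]; push_cast; ring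
  have e2 : Complex.exp (-(θ * Complex.I)) * Complex.exp (-(π * α) * Complex.I) = Complex.exp (-(π * μ * Complex.I)) * Complex.exp (-(((θ + π * ν : ℝ) : ℂ) * Complex.I)) := by
    simp only [← Complex.exp_add]
    congr 1; rw [hν, hμ]; push_cast; ring
  have hpi : (π : ℂ) ≠ 0 := by exact_mod_cast pi_ne_zero
  have hI : (1:ℂ) / (2 * π * Complex.I) = -Complex.I / (2 * π) := by
    rw [div_eq_div_iff (by simp [hpi]) (by simp [hpi])]
    linear_combination (2 * π : ℂ) * Complex.I_sq
  rw [hI]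
  linear_combination (-Complex.I / (2 * π)) * Complex.Gamma ((1 - α : ℝ) : ℂ) * (e1 - e2)

lemma g_pos (α u : ℝ) (hu : 0 < u) : Ghat α (2*α/3) u 1 =
    -(2/3) * (e23 * wrightPhi (-(α/3)) ((2*α/3 : ℝ) : ℂ) (e23 * u)).re := by
  rw [Ghat, if_neg hu.ne', Gfun, if_neg (not_lt.mpr hu.le)]
  simp

lemma g_neg (α u : ℝ) (hu : 0 < u) : Ghat α (2*α/3) (-u) 1 =
    (1/3) * (wrightPhi (-(α/3)) ((2*α/3 : ℝ) : ℂ) (-1 * u)).re := by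
  rw [Ghat, if_neg (by linarith), Gfun, if_pos (by linarith)]
  simp

lemma g_int (α : ℝ) (hα0 : 0 < α) (hα1 : α < 1) :
    Integrable (fun u => Ghat α (2*α/3) u 1) ∧ ∫ u, Ghat α (2*α/3) u 1 = 1 / Real.Gamma α := by
  have hpp := pi_pos
  have hpa : 0 < π * α := by positivity
  have hpa1 : π * α < π := by nlinarith
  have hpa2 : 0 < π * α * α := by positivity
  have hpa3 : 0 < π * (1 - α) ^ 2 := by
    have : 0 < 1 - α := by linarith
    positivity
  obtain ⟨I1, V1⟩ := wright_ray α (2 * π / 3) hα0 hα1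
    (Real.cos_neg_of_pi_div_two_lt_of_lt (by nlinarith) (by nlinarith))
    (Real.cos_neg_of_pi_div_two_lt_of_lt (by nlinarith) (by nlinarith))
  obtain ⟨I2, V2⟩ := wright_ray α π hα0 hα1
    (Real.cos_neg_of_pi_div_two_lt_of_lt (by nlinarith) (by nlinarith))
    (Real.cos_neg_of_pi_div_two_lt_of_lt (by nlinarith) (by nlinarith))
  have he : Complex.exp (((2 * π / 3 : ℝ) : ℂ) * Complex.I) = e23 := by
    rw [e23]; congr 1; push_cast; ring
  have he0 : e23 ≠ 0 := Complex.exp_ne_zero _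
  rw [Complex.exp_neg, he] at V1
  rw [he] at I1
  rw [Complex.exp_neg, Complex.exp_pi_mul_I] at V2
  rw [Complex.exp_pi_mul_I] at I2
  have I1' := I1.const_mul e23
  have A1 : IntegrableOn (fun u => Ghat α (2*α/3) u 1) (Ioi 0) := by
    refine IntegrableOn.congr_fun (I1'.re.const_mul (-(2/3))) (fun u hu => ?_) measurableSet_Ioi
    exact (g_pos α u hu).symm
  have B1 : ∫ u in Ioi (0:ℝ), Ghat α (2*α/3) u 1 = 2/3 * (1 / Real.Gamma α) := by
    rw [setIntegral_congr_fun measurableSet_Ioi (fun u hu => g_pos α u hu), integral_const_mul]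
    have := integral_re I1'
    simp only [RCLike.re_to_complex] at this
    rw [this, integral_const_mul, V1]
    have : e23 * -(e23⁻¹ * ((1 / Real.Gamma α : ℝ) : ℂ)) = ((-(1 / Real.Gamma α) : ℝ) : ℂ) := by
      push_cast; field_simp
    rw [this, Complex.ofReal_re]; ring
  have A2' : IntegrableOn (fun u => Ghat α (2*α/3) (-u) 1) (Ioi 0) := by
    refine IntegrableOn.congr_fun (I2.re.const_mul (1/3)) (fun u hu => ?_) measurableSet_Ioi
    exact (g_neg α u hu).symm
  have A2 : IntegrableOn (fun u => Ghat α (2*α/3) u 1) (Iic 0) := by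
    rw [integrableOn_Iic_iff_integrableOn_Iio]
    have := (Measure.measurePreserving_neg (volume : Measure ℝ)).integrableOn_comp_preimage
      (MeasurableEquiv.neg ℝ).measurableEmbedding (f := fun u => Ghat α (2*α/3) u 1) (s := Iio 0)
    apply this.mp
    simpa [Function.comp_def] using A2'
  have B2 : ∫ u in Iic (0:ℝ), Ghat α (2*α/3) u 1 = 1/3 * (1 / Real.Gamma α) := by
    have h := integral_comp_neg_Ioi 0 (fun u => Ghat α (2*α/3) u 1)
    rw [neg_zero] at h
    rw [← h, setIntegral_congr_fun measurableSet_Ioi (fun u hu => g_neg α u hu), integral_const_mul]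
    have := integral_re I2
    simp only [RCLike.re_to_complex] at this
    rw [this, V2]
    have : -((-1 : ℂ)⁻¹ * ((1 / Real.Gamma α : ℝ) : ℂ)) = (((1 / Real.Gamma α) : ℝ) : ℂ) := by
      push_cast; norm_num
    rw [this, Complex.ofReal_re]
  constructor
  · rw [← integrableOn_univ, ← Iic_union_Ioi (a := (0:ℝ))]
    exact A2.union A1
  · rw [← intervalIntegral.integral_Iic_add_Ioi A2 A1, B1, B2]; ring

lemma G_scale (α y s : ℝ) (hs : 0 < s) : Ghat α (2*α/3) y s =
    s ^ (2*α/3 - 1) * Ghat α (2*α/3) (y / s ^ (α/3)) 1 := by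
  have hp : 0 < s ^ (α/3) := by positivity
  have h0 : y / s ^ (α/3) = 0 ↔ y = 0 := by simp [hp.ne']
  have h1 : y / s ^ (α/3) < 0 ↔ y < 0 := by rw [div_lt_iff₀ hp, zero_mul]
  simp only [Ghat, Gfun, h0, h1, Real.one_rpow, div_one]
  split_ifs <;> ring

lemma beta_real (α : ℝ) (hα0 : 0 < α) (hα1 : α < 1) :
    IntervalIntegrable (fun r : ℝ => r ^ (α - 1) * (1 - r) ^ (-α)) volume 0 1 ∧
    ∫ r in (0:ℝ)..1, r ^ (α - 1) * (1 - r) ^ (-α) = Real.Gamma α * Real.Gamma (1 - α) := by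
  have hc := Complex.betaIntegral_convergent (u := α) (v := ((1 - α : ℝ) : ℂ)) (by simpa using hα0) (by simp [hα1])
  have hb := Complex.Gamma_mul_Gamma_eq_betaIntegral (s := α) (t := ((1 - α : ℝ) : ℂ)) (by simpa using hα0) (by simp [hα1])
  have heq : ∀ r ∈ uIcc (0:ℝ) 1, (r:ℂ) ^ ((α:ℂ) - 1) * (1 - (r:ℂ)) ^ (((1 - α : ℝ) : ℂ) - 1) =
      ((r ^ (α - 1) * (1 - r) ^ (-α) : ℝ) : ℂ) := by
    intro r hr
    rw [uIcc_of_le zero_le_one] at hr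
    rw [Complex.ofReal_mul, Complex.ofReal_cpow hr.1, Complex.ofReal_cpow (by linarith [hr.2])]
    push_cast
    ring_nf
  constructor
  · have h2 : IntervalIntegrable (fun r : ℝ => ((r ^ (α - 1) * (1 - r) ^ (-α) : ℝ) : ℂ)) volume 0 1 :=
      hc.congr (fun r hr => heq r (uIoc_subset_uIcc hr))
    rw [intervalIntegrable_iff] at h2 ⊢
    exact h2.re
  · rw [Complex.betaIntegral, intervalIntegral.integral_congr heq, intervalIntegral.integral_ofReal,
      Complex.Gamma_ofReal, Complex.Gamma_ofReal] at hb
    have : (α:ℂ) + ((1 - α : ℝ) : ℂ) = 1 := by push_cast; ring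
    rw [this, Complex.Gamma_one, one_mul] at hb
    exact_mod_cast hb.symm

theorem potential_w5_initial_value
    (α : ℝ) (hα0 : 0 < α) (hα1 : α < 1) (a b : ℝ) (hab : a < b)
    (τ₅ : ℝ → ℝ) (hτ₅ : ContinuousOn τ₅ (Set.Icc a b))
    (w₅ : ℝ → ℝ → ℝ)
    (hw₅ : ∀ x t, w₅ x t = ∫ ξ in a..b, Ghat α (2*α/3) (x - ξ) t * τ₅ ξ) :
    ∀ x ∈ Set.Ioo a b,
      Filter.Tendsto (fun t => fracJ (1 - α) (fun s => w₅ x s) t)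
        (nhdsWithin 0 (Set.Ioi 0)) (nhds (τ₅ x)) := by
  intro x hx
  obtain ⟨gI, gV⟩ := g_int α hα0 hα1
  obtain ⟨bI, bV⟩ := beta_real α hα0 hα1
  set g : ℝ → ℝ := fun u => Ghat α (2*α/3) u 1 with hg
  set ν : ℝ := α / 3 with hν
  have hν0 : 0 < ν := by positivity
  set T : ℝ → ℝ := (Ioc a b).indicator (Set.IccExtend hab.le ((Icc a b).domRestrict τ₅)) with hT
  have hTm : Measurable T :=
    (continuous_IccExtend_iff.mpr (continuousOn_iff_continuous_domRestrict.mp hτ₅)).measurable.indicator measurableSet_Ioc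
  have hTe : ∀ ξ ∈ Ioc a b, T ξ = τ₅ ξ := by
    intro ξ hξ
    rw [hT, indicator_of_mem hξ, IccExtend_of_mem _ _ (Ioc_subset_Icc_self hξ)]
    rfl
  have hT0 : ∀ ξ, ξ ∉ Ioc a b → T ξ = 0 := fun ξ hξ => indicator_of_notMem hξ _
  obtain ⟨M, hM⟩ := isCompact_Icc.exists_bound_of_continuousOn hτ₅
  have hM0 : 0 ≤ M := (norm_nonneg _).trans (hM x (Ioo_subset_Icc_self hx))
  have hTM : ∀ ξ, ‖T ξ‖ ≤ M := by
    intro ξ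
    by_cases h : ξ ∈ Ioc a b
    · rw [hTe ξ h]; exact hM ξ (Ioc_subset_Icc_self h)
    · rw [hT0 ξ h, norm_zero]; exact hM0
  have hTc : Tendsto T (𝓝 x) (𝓝 (τ₅ x)) := by
    have h1 : Tendsto τ₅ (𝓝 x) (𝓝 (τ₅ x)) := (hτ₅.continuousAt (Icc_mem_nhds hx.1 hx.2))
    refine h1.congr' ?_
    filter_upwards [Ioo_mem_nhds hx.1 hx.2] with ξ hξ
    exact (hTe ξ (Ioo_subset_Ioc_self hξ)).symm
  set H : ℝ → ℝ := fun s => ∫ u, g u * T (x - s ^ ν * u) with hH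
  have hHb : ∀ s, ‖H s‖ ≤ ∫ u, ‖g u‖ * M := by
    intro s
    refine norm_integral_le_of_norm_le (gI.norm.mul_const M) (Eventually.of_forall fun u => ?_)
    rw [norm_mul]
    exact mul_le_mul_of_nonneg_left (hTM _) (norm_nonneg _)
  have hHl : Tendsto H (𝓝[>] 0) (𝓝 (1 / Real.Gamma α * τ₅ x)) := by
    rw [← gV, ← integral_mul_const]
    refine tendsto_integral_filter_of_dominated_convergence (fun u => ‖g u‖ * M) ?_ ?_ (gI.norm.mul_const M) ?_
    · refine Eventually.of_forall fun s => ?_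
      exact gI.aestronglyMeasurable.mul (hTm.comp (by fun_prop)).aestronglyMeasurable
    · refine Eventually.of_forall fun s => Eventually.of_forall fun u => ?_
      rw [norm_mul]
      exact mul_le_mul_of_nonneg_left (hTM _) (norm_nonneg _)
    · refine Eventually.of_forall fun u => ?_
      refine Tendsto.const_mul _ (hTc.comp ?_)
      have h1 : Tendsto (fun s : ℝ => s ^ ν) (𝓝[>] 0) (𝓝 0) := by
        have := (Real.continuousAt_rpow_const 0 ν (Or.inr hν0.le)).tendsto
        rw [Real.zero_rpow hν0.ne'] at this
        exact this.mono_left nhdsWithin_le_nhds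
      have := (h1.mul_const u).const_sub x
      simpa using this
  have hw : ∀ s, 0 < s → w₅ x s = s ^ (α - 1) * H s := by
    intro s hs
    have hp : 0 < s ^ ν := by positivity
    have e1 : ∀ ξ ∈ Ioc a b, Ghat α (2*α/3) (x - ξ) s * τ₅ ξ = s ^ (2*α/3 - 1) * (g ((x - ξ) / s ^ ν) * T ξ) := by
      intro ξ hξ
      rw [G_scale α _ s hs, hTe ξ hξ, mul_assoc]
    rw [hw₅, intervalIntegral.integral_of_le hab.le, setIntegral_congr_fun measurableSet_Ioc e1,
      integral_const_mul, setIntegral_eq_integral_of_forall_compl_eq_zero (fun ξ hξ => by rw [hT0 ξ hξ, mul_zero])]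
    have e2 := integral_sub_left_eq_self (fun ξ => g ((x - ξ) / s ^ ν) * T ξ) volume x
    have e3 := Measure.integral_comp_div (fun u => g u * T (x - s ^ ν * u)) (s ^ ν)
    have e4 : (fun ξ => g (ξ / s ^ ν) * T (x - s ^ ν * (ξ / s ^ ν))) = fun ξ => g ((x - (x - ξ)) / s ^ ν) * T (x - ξ) := by
      ext ξ
      rw [mul_div_cancel₀ _ hp.ne', sub_sub_cancel]
    rw [e4, e2, abs_of_pos hp, smul_eq_mul] at e3
    rw [e3, ← mul_assoc, ← Real.rpow_add hs]
    congr 2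
    rw [hν]; ring
  have hJ : ∀ t, 0 < t → fracJ (1 - α) (fun s => w₅ x s) t =
      (1 / Real.Gamma (1 - α)) * ∫ r in (0:ℝ)..1, (r ^ (α - 1) * (1 - r) ^ (-α)) * H (t * r) := by
    intro t ht
    rw [fracJ]
    congr 1
    have h := intervalIntegral.mul_integral_comp_mul_left (a := 0) (b := 1) (f := fun ξ => w₅ x ξ * (t - ξ) ^ (1 - α - 1)) t
    rw [mul_zero, mul_one] at h
    rw [← h, ← intervalIntegral.integral_const_mul]
    refine intervalIntegral.integral_congr_ae (Eventually.of_forall fun r hr => ?_)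
    rw [uIoc_of_le zero_le_one] at hr
    have hr0 : 0 < r := hr.1
    have hr1 : 0 ≤ 1 - r := by linarith [hr.2]
    have e1 : t - t * r = t * (1 - r) := by ring
    have e2 : (1 - α - 1) = -α := by ring
    rw [hw _ (by positivity), e1, e2, Real.mul_rpow ht.le hr0.le, Real.mul_rpow ht.le hr1]
    have e3 : t * t ^ (α - 1) * t ^ (-α) = 1 := by
      rw [mul_comm t, ← Real.rpow_add_one ht.ne', ← Real.rpow_add ht]; simp
    linear_combination (r ^ (α - 1) * (1 - r) ^ (-α) * H (t * r)) * e3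
  have hlim : Tendsto (fun t => (1 / Real.Gamma (1 - α)) * ∫ r in (0:ℝ)..1, (r ^ (α - 1) * (1 - r) ^ (-α)) * H (t * r))
      (𝓝[>] 0) (𝓝 ((1 / Real.Gamma (1 - α)) * ∫ r in (0:ℝ)..1, (r ^ (α - 1) * (1 - r) ^ (-α)) * (1 / Real.Gamma α * τ₅ x))) := by
    refine Tendsto.const_mul _ ?_
    refine intervalIntegral.tendsto_integral_filter_of_dominated_convergence
      (fun r => ‖r ^ (α - 1) * (1 - r) ^ (-α)‖ * ∫ u, ‖g u‖ * M) ?_ ?_ (bI.norm.mul_const _) ?_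
    · refine Eventually.of_forall fun t => ?_
      refine AEStronglyMeasurable.mul (Measurable.aestronglyMeasurable (by fun_prop)) ?_
      refine AEStronglyMeasurable.integral_prod_right' (f := fun p : ℝ × ℝ => g p.2 * T (x - (t * p.1) ^ ν * p.2)) ?_
      exact (gI.aestronglyMeasurable.comp_snd).mul (hTm.comp (by fun_prop)).aestronglyMeasurable
    · refine Eventually.of_forall fun t => Eventually.of_forall fun r _ => ?_
      rw [norm_mul]
      exact mul_le_mul_of_nonneg_left (hHb _) (norm_nonneg _)
    · refine Eventually.of_forall fun r hr => ?_
      rw [uIoc_of_le zero_le_one] at hr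
      refine Tendsto.const_mul _ (hHl.comp ?_)
      rw [tendsto_nhdsWithin_iff]
      constructor
      · have : Tendsto (fun t : ℝ => t * r) (𝓝 0) (𝓝 (0 * r)) := tendsto_id.mul_const r
        rw [zero_mul] at this
        exact this.mono_left nhdsWithin_le_nhds
      · filter_upwards [self_mem_nhdsWithin] with t ht
        exact mul_pos ht hr.1
  have hval : (1 / Real.Gamma (1 - α)) * ∫ r in (0:ℝ)..1, (r ^ (α - 1) * (1 - r) ^ (-α)) * (1 / Real.Gamma α * τ₅ x) = τ₅ x := by
    rw [intervalIntegral.integral_mul_const, bV]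
    have h1 : Real.Gamma α ≠ 0 := (Real.Gamma_pos_of_pos hα0).ne'
    have h2 : Real.Gamma (1 - α) ≠ 0 := (Real.Gamma_pos_of_pos (by linarith)).ne'
    field_simp
  rw [hval] at hlim
  refine hlim.congr' ?_
  filter_upwards [self_mem_nhdsWithin] with t ht
  exact (hJ t ht).symm
end

section
/- Let 0<α<1 and define g_α : ℝ → ℝ by g_α(y) = (1/3)φ(−α/3, 1−α/3; y) for y<0 and g_α(y) = −(2/3)Re[e^{2πi/3} φ(−α/3, 1−α/3; e^{2πi/3} y)] for y>0. Then g_α is integrable on ℝ and ∫_{−∞}^{+∞} g_α(y) dy = 1; equivalently, (1/3)∫_{−∞}^0 φ(−α/3,1−α/3;y)dy − (2/3)Re[e^{2πi/3}∫_0^{+∞} φ(−α/3,1−α/3;e^{2πi/3}y)dy] = 1. -/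
open MeasureTheory Real Filter Set Topology

/-- The spatial profile `g_α` of the fundamental solution `G_α^{1−α/3}`. -/
noncomputable def gA (α : ℝ) (y : ℝ) : ℝ :=
  if y < 0 then (1/3) * (wrightPhi (-(α/3)) (1 - α/3) (y : ℂ)).re
  else -(2/3) * (e23 * wrightPhi (-(α/3)) (1 - α/3) (e23 * (y : ℂ))).re


lemma aux_inv_gamma (s : ℝ) (hs : 0 < s) :
    (Complex.Gamma (1 - s))⁻¹ = Complex.Gamma s * Complex.sin (π * s) / π := by
  have h := Complex.Gamma_mul_Gamma_one_sub (s : ℂ)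
  have hg : Complex.Gamma s ≠ 0 := Complex.Gamma_ne_zero_of_re_pos (by simpa using hs)
  have hpi : (π : ℂ) ≠ 0 := by exact_mod_cast pi_ne_zero
  by_cases h0 : Complex.sin (π * s) = 0
  · rw [h0, div_zero] at h
    rcases mul_eq_zero.mp h with h | h
    · exact absurd h hg
    · simp [h, h0]
  · have : Complex.Gamma (1 - s) = π / Complex.sin (π * s) / Complex.Gamma s := by
      rw [← h]; field_simp
    rw [this]; field_simp

lemma aux_norm_inv_gamma (s : ℝ) (hs : 0 ≤ s) :
    ‖(Complex.Gamma (1 - s))⁻¹‖ ≤ Real.Gamma (s + 1) := by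
  rcases hs.eq_or_lt with rfl | hs
  · simp
  rw [aux_inv_gamma s hs, Complex.Gamma_ofReal, Real.Gamma_add_one hs.ne',
    show Complex.sin (π * s) = ((Real.sin (π * s) : ℝ) : ℂ) by push_cast; rfl]
  rw [← Complex.ofReal_mul, ← Complex.ofReal_div, Complex.norm_real, Real.norm_eq_abs,
    abs_div, abs_mul, abs_of_pos (Real.Gamma_pos_of_pos hs), abs_of_pos pi_pos,
    div_le_iff₀ pi_pos]
  have h1 : |Real.sin (π * s)| ≤ π * s := by
    have := Real.abs_sin_le_abs (x := π * s)
    rwa [abs_of_pos (by positivity : 0 < π * s)] at this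
  have := mul_le_mul_of_nonneg_left h1 (Real.Gamma_pos_of_pos hs).le
  linarith

lemma aux_gamma_le (x y : ℝ) (hx : 1 ≤ x) (hxy : x + 1 ≤ y) : Real.Gamma x ≤ Real.Gamma y := by
  have h1 : Real.Gamma (x + 1) ≤ Real.Gamma y :=
    Real.Gamma_strictMonoOn_Ici.monotoneOn (by simp; linarith) (by simp; linarith) hxy
  rw [Real.Gamma_add_one (by linarith)] at h1
  have := Real.Gamma_pos_of_pos (by linarith : 0 < x)
  nlinarith

lemma aux_summ (β : ℝ) (h0 : 0 < β) (h1 : β < 1) (R : ℝ) (hR : 0 ≤ R) :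
    Summable (fun n : ℕ => R ^ n / (n.factorial : ℝ) * Real.Gamma (β * n + 3)) := by
  wlog hRp : 0 < R generalizing R
  · have := this 1 (by norm_num) (by norm_num)
    have hR0 : R = 0 := by linarith
    subst hR0
    refine summable_of_ne_finset_zero (s := {0}) ?_
    intro n hn
    simp at hn
    simp [hn]
  set C := Real.Gamma ((3 - β) / (1 - β)) ^ (1 - β)
  have hb : ∀ n : ℕ, Real.Gamma (β * n + 3) ≤ (n.factorial : ℝ) ^ β * C := by
    intro n
    have := Real.Gamma_mul_add_mul_le_rpow_Gamma_mul_rpow_Gamma (s := (n : ℝ) + 1)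
      (t := (3 - β) / (1 - β)) (a := β) (b := 1 - β) (by positivity)
      (div_pos (by linarith) (by linarith)) h0 (by linarith) (by ring)
    rw [Real.Gamma_nat_eq_factorial] at this
    convert this using 2
    have : 1 - β ≠ 0 := by linarith
    field_simp
    ring
  have hs : Summable (fun n : ℕ => R ^ n / (n.factorial : ℝ) * ((n.factorial : ℝ) ^ β)) := by
    refine summable_of_ratio_test_tendsto_lt_one (l := 0) (by norm_num) ?_ ?_
    · refine Eventually.of_forall fun n => ?_
      positivity
    · have h2 : Tendsto (fun n : ℕ => R * ((n : ℝ) + 1) ^ (-(1 - β))) atTop (𝓝 (R * 0)) := by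
        refine Tendsto.const_mul _ ?_
        exact (tendsto_rpow_neg_atTop (by linarith : 0 < 1 - β)).comp
          (tendsto_atTop_add_const_right _ _ tendsto_natCast_atTop_atTop)
      rw [mul_zero] at h2
      refine h2.congr fun n => ?_
      rw [Real.norm_of_nonneg (by positivity), Real.norm_of_nonneg (by positivity),
        Nat.factorial_succ]
      push_cast
      rw [Real.mul_rpow (by positivity) (by positivity), neg_sub,
        Real.rpow_sub_one (by positivity)]
      have : (n.factorial : ℝ) ^ β ≠ 0 := by positivity
      have : (n.factorial : ℝ) ≠ 0 := by positivity
      field_simp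
      ring
  refine Summable.of_nonneg_of_le (fun n => ?_) (fun n => ?_) (hs.mul_right C)
  · have := Real.Gamma_pos_of_pos (by positivity : 0 < β * n + 3)
    positivity
  · rw [mul_assoc]
    exact mul_le_mul_of_nonneg_left (hb n) (by positivity)

lemma aux_coef (β : ℝ) (h0 : 0 < β) (ν : ℝ) (hν0 : 0 ≤ ν) (hν1 : ν ≤ 1) (n : ℕ) :
    ‖(Complex.Gamma (-(β : ℂ) * n + (1 - ν)))⁻¹‖ ≤ Real.Gamma (β * n + 3) := by
  have h := aux_norm_inv_gamma (β * n + ν) (by positivity)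
  have h2 := aux_gamma_le (β * n + ν + 1) (β * n + 3) (by nlinarith [show 0 ≤ β * n by positivity]) (by linarith)
  refine le_trans (le_of_eq ?_) (h.trans h2)
  congr 3
  push_cast; ring

lemma aux_term (β : ℝ) (h0 : 0 < β) (ν : ℝ) (hν0 : 0 ≤ ν) (hν1 : ν ≤ 1) (z : ℂ) (n : ℕ) :
    ‖z ^ n / ((n.factorial : ℂ) * Complex.Gamma (-(β : ℂ) * n + (1 - ν)))‖ ≤
      ‖z‖ ^ n / (n.factorial : ℝ) * Real.Gamma (β * n + 3) := by
  rw [← div_div, div_eq_mul_inv _ (Complex.Gamma _), norm_mul, norm_div, norm_pow,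
    Complex.norm_natCast]
  exact mul_le_mul_of_nonneg_left (aux_coef β h0 ν hν0 hν1 n) (by positivity)

lemma aux_dterm (β : ℝ) (h0 : 0 < β) (ν : ℝ) (hν0 : 0 ≤ ν) (hν1 : ν ≤ 1) (z : ℂ) (R : ℝ)
    (hR : 1 ≤ R) (hz : ‖z‖ ≤ R) (n : ℕ) :
    ‖(n * z ^ (n - 1)) / ((n.factorial : ℂ) * Complex.Gamma (-(β : ℂ) * n + (1 - ν)))‖ ≤
      (2 * R) ^ n / (n.factorial : ℝ) * Real.Gamma (β * n + 3) := by
  rw [← div_div, div_eq_mul_inv _ (Complex.Gamma _), norm_mul, norm_div, norm_mul, norm_pow,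
    Complex.norm_natCast, Complex.norm_natCast]
  refine mul_le_mul ?_ (aux_coef β h0 ν hν0 hν1 n) (by positivity) (by positivity)
  gcongr
  rw [mul_pow]
  refine mul_le_mul ?_ ?_ (by positivity) (by positivity)
  · exact_mod_cast Nat.lt_two_pow_self.le
  · exact (pow_le_pow_left₀ (norm_nonneg _) hz _).trans (pow_le_pow_right₀ hR (by omega))

lemma aux_deriv (β : ℝ) (h0 : 0 < β) (h1 : β < 1) (ν : ℝ) (hν0 : 0 ≤ ν) (hν1 : ν ≤ 1) (z : ℂ) :
    HasDerivAt (fun z => wrightPhi (-(β : ℂ)) (1 - ν) z)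
      (wrightPhi (-(β : ℂ)) (1 - ν - β) z) z := by
  set R := ‖z‖ + 1
  have hR : 1 ≤ R := by simp [R]
  have hsum := aux_summ β h0 h1 (2 * R) (by positivity)
  have key := hasDerivAt_tsum_of_isPreconnected (𝕜 := ℂ)
    (g := fun (n : ℕ) (z : ℂ) => z ^ n / ((n.factorial : ℂ) * Complex.Gamma (-(β : ℂ) * n + (1 - ν))))
    (g' := fun (n : ℕ) (z : ℂ) => (n * z ^ (n - 1)) / ((n.factorial : ℂ) * Complex.Gamma (-(β : ℂ) * n + (1 - ν))))
    (t := Metric.ball (0 : ℂ) R) (y₀ := 0) (y := z) hsum Metric.isOpen_ball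
    (convex_ball _ _).isPreconnected
    (fun n y _ => (hasDerivAt_pow n y).div_const _) ?_ (by simp; linarith) ?_ (by simp [R])
  · unfold wrightPhi
    refine key.congr_deriv ?_
    have hs : Summable (fun n : ℕ => (n * z ^ (n - 1)) / ((n.factorial : ℂ) * Complex.Gamma (-(β : ℂ) * n + (1 - ν)))) := by
      exact Summable.of_norm_bounded hsum fun n =>
        aux_dterm β h0 ν hν0 hν1 z R hR (by simp [R]) n
    rw [hs.tsum_eq_zero_add]
    simp only [Nat.cast_zero, zero_mul, zero_div, zero_add, Nat.add_sub_cancel]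
    refine tsum_congr fun n => ?_
    rw [Nat.factorial_succ]
    push_cast
    have : (n : ℂ) + 1 ≠ 0 := by exact_mod_cast Nat.succ_ne_zero n
    rw [mul_assoc, mul_div_mul_left _ _ this]
    congr 3
    ring
  · intro n y hy
    exact aux_dterm β h0 ν hν0 hν1 y R hR (by simpa using (mem_ball_zero_iff.mp hy).le) n
  · refine Summable.of_norm_bounded (aux_summ β h0 h1 ‖(0:ℂ)‖ (by simp)) fun n => aux_term β h0 ν hν0 hν1 0 n

lemma aux_lap_int (s : ℝ) (hs : -1 < s) (r : ℂ) (hr : 0 < r.re) :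
    IntegrableOn (fun t : ℝ => ((t ^ s : ℝ) : ℂ) * Complex.exp (-(r * t))) (Ioi 0) := by
  have hi := integrableOn_rpow_mul_exp_neg_mul_rpow (p := 1) hs one_pos hr
  refine Integrable.mono' hi (Measurable.aestronglyMeasurable (by fun_prop)) ?_
  filter_upwards [ae_restrict_mem measurableSet_Ioi] with t ht
  rw [norm_mul, Complex.norm_exp, Complex.norm_real,
    Real.norm_of_nonneg (Real.rpow_nonneg (le_of_lt ht) _), Real.rpow_one, Complex.neg_re,
    Complex.re_mul_ofReal, neg_mul]

lemma aux_lap_diff (s : ℝ) (hs : -1 < s) (r : ℂ) (hr : 0 < r.re) :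
    DifferentiableAt ℂ (fun r : ℂ => ∫ t in Ioi (0:ℝ), ((t ^ s : ℝ) : ℂ) * Complex.exp (-(r * t))) r := by
  have hε : 0 < r.re / 2 := by positivity
  have hb := integrableOn_rpow_mul_exp_neg_mul_rpow (p := 1) (s := s + 1) (by linarith) one_pos hε
  have := hasDerivAt_integral_of_dominated_loc_of_deriv_le (𝕜 := ℂ)
    (μ := volume.restrict (Ioi (0:ℝ))) (x₀ := r)
    (F := fun (r : ℂ) (t : ℝ) => ((t ^ s : ℝ) : ℂ) * Complex.exp (-(r * t)))
    (F' := fun (r : ℂ) (t : ℝ) => ((t ^ s : ℝ) : ℂ) * (Complex.exp (-(r * t)) * (-(1 * t))))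
    (Metric.ball_mem_nhds r hε)
    (Eventually.of_forall fun z => Measurable.aestronglyMeasurable (by fun_prop))
    (aux_lap_int s hs r hr)
    (Measurable.aestronglyMeasurable (by fun_prop))
    (bound := fun t => t ^ (s + 1) * Real.exp (-(r.re / 2) * t ^ (1:ℝ))) ?_ hb ?_
  · exact this.2.differentiableAt
  · filter_upwards [ae_restrict_mem measurableSet_Ioi] with t ht z hz
    have ht : 0 < t := ht
    have hz2 : r.re / 2 ≤ z.re := by
      have h1 := Complex.abs_re_le_norm (z - r)
      rw [mem_ball_iff_norm] at hz
      have := abs_lt.mp (h1.trans_lt hz)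
      simp at this
      linarith
    rw [norm_mul, norm_mul, Complex.norm_exp, Complex.norm_real, one_mul, norm_neg, Complex.norm_real,
      Real.norm_of_nonneg (Real.rpow_nonneg ht.le _), Real.norm_of_nonneg ht.le, Real.rpow_one,
      Complex.neg_re, Complex.re_mul_ofReal, Real.rpow_add_one ht.ne']
    have : Real.exp (-(z.re * t)) ≤ Real.exp (-(r.re / 2) * t) := by
      rw [Real.exp_le_exp]; nlinarith
    calc _ ≤ t ^ s * (Real.exp (-(r.re / 2) * t) * t) := by gcongr
      _ = _ := by ring
  · refine Eventually.of_forall fun t z _ => ?_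
    exact (((hasDerivAt_id z).mul_const (t : ℂ)).neg.cexp).const_mul _

lemma aux_laplace (s : ℝ) (hs : 0 < s) (r : ℂ) (hr : 0 < r.re) :
    ∫ t in Ioi (0:ℝ), ((t ^ (s - 1) : ℝ) : ℂ) * Complex.exp (-(r * t)) =
      r ^ (-(s : ℂ)) * Complex.Gamma s := by
  have hopen : IsOpen {z : ℂ | 0 < z.re} := isOpen_lt continuous_const Complex.continuous_re
  have hconv : Convex ℝ {z : ℂ | 0 < z.re} := convex_halfSpace_re_gt 0
  have A : AnalyticOnNhd ℂ (fun r : ℂ => ∫ t in Ioi (0:ℝ), ((t ^ (s - 1) : ℝ) : ℂ) *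
      Complex.exp (-(r * t))) {z : ℂ | 0 < z.re} :=
    DifferentiableOn.analyticOnNhd (fun z hz =>
      (aux_lap_diff (s - 1) (by linarith) z hz).differentiableWithinAt) hopen
  have B : AnalyticOnNhd ℂ (fun r : ℂ => r ^ (-(s : ℂ)) * Complex.Gamma s) {z : ℂ | 0 < z.re} :=
    DifferentiableOn.analyticOnNhd (fun z hz =>
      ((differentiableAt_id.cpow_const (Or.inl hz)).mul_const _).differentiableWithinAt) hopen
  refine A.eqOn_of_preconnected_of_frequently_eq B hconv.isPreconnected (z₀ := 1) (by simp) ?_ hr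
  have hT : Tendsto (fun x : ℝ => (x : ℂ)) (𝓝[≠] 1) (𝓝[≠] 1) := by
    refine tendsto_nhdsWithin_iff.mpr ⟨?_, ?_⟩
    · exact (Complex.continuous_ofReal.tendsto' 1 1 (by simp)).mono_left nhdsWithin_le_nhds
    · filter_upwards [self_mem_nhdsWithin] with x hx
      simpa using hx
  refine hT.frequently (Eventually.frequently ?_)
  filter_upwards [mem_nhdsWithin_of_mem_nhds (lt_mem_nhds (zero_lt_one (α := ℝ)))] with x hx
  have := Complex.integral_cpow_mul_exp_neg_mul_Ioi (a := s) (by simpa using hs) hx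
  rw [one_div, Complex.inv_cpow _ _ (by rw [Complex.arg_ofReal_of_nonneg hx.le]; exact pi_pos.ne),
    ← Complex.cpow_neg] at this
  rw [← this]
  refine setIntegral_congr_fun measurableSet_Ioi fun t ht => ?_
  rw [Complex.ofReal_cpow (le_of_lt ht)]
  push_cast
  rfl

lemma aux_gamma_int (ψ : ℝ) (h1 : -(π/2) < ψ) (h2 : ψ < π/2) (s : ℝ) (hs : 0 < s) :
    ∫ t in Ioi (0:ℝ), ((t ^ (s - 1) : ℝ) : ℂ) * Complex.exp (-(Complex.exp (ψ * Complex.I) * t)) =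
      Complex.exp (-(ψ * s * Complex.I)) * Complex.Gamma s := by
  have hr : 0 < (Complex.exp (ψ * Complex.I)).re := by
    rw [Complex.exp_ofReal_mul_I_re]; exact Real.cos_pos_of_mem_Ioo ⟨h1, h2⟩
  rw [aux_laplace s hs _ hr, Complex.cpow_def_of_ne_zero (Complex.exp_ne_zero _),
    Complex.log_exp (by simp; linarith [pi_pos]) (by simp; linarith [pi_pos])]
  congr 2
  ring

lemma aux_norm_exp (η x : ℝ) : ‖Complex.exp (-(Complex.exp (η * Complex.I) * x))‖ =
    Real.exp (- (Real.cos η * x)) := by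
  rw [Complex.norm_exp]
  congr 1
  rw [Complex.neg_re, Complex.re_mul_ofReal, Complex.exp_ofReal_mul_I_re]

lemma aux_int1 (ψ : ℝ) (h1 : -(π/2) < ψ) (h2 : ψ < π/2) (s : ℝ) (hs : 0 < s) :
    IntegrableOn (fun t : ℝ => ((t ^ (s - 1) : ℝ) : ℂ) *
      Complex.exp (-(Complex.exp (ψ * Complex.I) * t))) (Ioi 0) ∧
    ∫ t in Ioi (0:ℝ), ‖((t ^ (s - 1) : ℝ) : ℂ) * Complex.exp (-(Complex.exp (ψ * Complex.I) * t))‖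
      = (1 / Real.cos ψ) ^ s * Real.Gamma s := by
  have hc : 0 < Real.cos ψ := Real.cos_pos_of_mem_Ioo ⟨h1, h2⟩
  have hn : ∀ t ∈ Ioi (0:ℝ), ‖((t ^ (s - 1) : ℝ) : ℂ) *
      Complex.exp (-(Complex.exp (ψ * Complex.I) * t))‖ =
      t ^ (s - 1) * Real.exp (-(Real.cos ψ * t)) := by
    intro t ht
    rw [norm_mul, aux_norm_exp, Complex.norm_real, Real.norm_of_nonneg
      (Real.rpow_nonneg (le_of_lt ht) _)]
  constructor
  · have hi := integrableOn_rpow_mul_exp_neg_mul_rpow (p := 1) (s := s - 1) (by linarith)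
      one_pos hc
    refine Integrable.mono' hi ?_ ?_
    · exact (by fun_prop : Measurable (fun t : ℝ => ((t ^ (s - 1) : ℝ) : ℂ) *
        Complex.exp (-(Complex.exp (ψ * Complex.I) * t)))).aestronglyMeasurable
    · filter_upwards [ae_restrict_mem measurableSet_Ioi] with t ht
      rw [hn t ht, Real.rpow_one, neg_mul]
  · rw [setIntegral_congr_fun measurableSet_Ioi hn]
    exact Real.integral_rpow_mul_exp_neg_mul_Ioi hs hc

lemma aux_A (β : ℝ) (hβ0 : 0 < β) (hβ1 : β < 1) (ν : ℝ) (hν0 : 0 < ν) (hν1 : ν ≤ 1)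
    (ψ : ℝ) (h1 : -(π/2) < ψ) (h2 : ψ < π/2) (u : ℂ) :
    HasSum (fun n : ℕ => (-u) ^ n / (n.factorial : ℂ) *
        (Complex.exp (-(ψ * (β * n + ν : ℝ) * Complex.I)) * Complex.Gamma (β * n + ν : ℝ)))
      (∫ t in Ioi (0:ℝ), ((t ^ (ν - 1) : ℝ) : ℂ) * Complex.exp (-(Complex.exp (ψ * Complex.I) * t))
        * Complex.exp (-(u * (t ^ β : ℝ)))) := by
  have hc : 0 < Real.cos ψ := Real.cos_pos_of_mem_Ioo ⟨h1, h2⟩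
  have hs : ∀ n : ℕ, 0 < β * n + ν := fun n => by positivity
  have key := hasSum_integral_of_summable_integral_norm (μ := volume.restrict (Ioi (0:ℝ)))
    (F := fun (n : ℕ) (t : ℝ) => (-u) ^ n / (n.factorial : ℂ) *
      (((t ^ (β * n + ν - 1) : ℝ) : ℂ) * Complex.exp (-(Complex.exp (ψ * Complex.I) * t))))
    (fun n => (aux_int1 ψ h1 h2 _ (hs n)).1.const_mul _) ?_
  · have e : (fun n : ℕ => (-u) ^ n / (n.factorial : ℂ) *
        (Complex.exp (-(ψ * (β * n + ν : ℝ) * Complex.I)) * Complex.Gamma (β * n + ν : ℝ))) =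
        fun n : ℕ => ∫ t in Ioi (0:ℝ), (-u) ^ n / (n.factorial : ℂ) *
      (((t ^ (β * n + ν - 1) : ℝ) : ℂ) * Complex.exp (-(Complex.exp (ψ * Complex.I) * t))) := by
      funext n
      rw [integral_const_mul, aux_gamma_int ψ h1 h2 _ (hs n)]
    rw [e]
    refine (congrArg (HasSum _) ?_).mp key
    · symm
      refine setIntegral_congr_fun measurableSet_Ioi fun t ht => ?_
      have ht : 0 < t := ht
      have hexp : Complex.exp (-(u * (t ^ β : ℝ))) =
          ∑' n : ℕ, (-(u * (t ^ β : ℝ))) ^ n / (n.factorial : ℂ) := by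
        rw [Complex.exp_eq_exp_ℂ, NormedSpace.exp_eq_tsum_div (𝔸 := ℂ)]
      rw [hexp, ← tsum_mul_left]
      refine tsum_congr fun n => ?_
      rw [show β * n + ν - 1 = (ν - 1) + β * n by ring, Real.rpow_add ht, Real.rpow_mul ht.le,
        Real.rpow_natCast]
      push_cast
      rw [← neg_mul u, mul_pow]
      ring
  · have hsum := aux_summ β hβ0 hβ1 (‖u‖ * (1 / Real.cos ψ) ^ β) (by positivity)
    refine Summable.of_nonneg_of_le (fun n => integral_nonneg fun t => norm_nonneg _) (fun n => ?_)
      (hsum.mul_left ((1 / Real.cos ψ) ^ ν * ν⁻¹))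
    have : ∀ t : ℝ, ‖(-u) ^ n / (n.factorial : ℂ) *
      (((t ^ (β * n + ν - 1) : ℝ) : ℂ) * Complex.exp (-(Complex.exp (ψ * Complex.I) * t)))‖ =
      ‖u‖ ^ n / (n.factorial : ℝ) * ‖((t ^ (β * n + ν - 1) : ℝ) : ℂ) *
        Complex.exp (-(Complex.exp (ψ * Complex.I) * t))‖ := by
      intro t
      rw [norm_mul, norm_div, norm_pow, norm_neg, Complex.norm_natCast]
    simp only [this]
    rw [integral_const_mul, (aux_int1 ψ h1 h2 _ (hs n)).2]
    have hg : Real.Gamma (β * n + ν) ≤ ν⁻¹ * Real.Gamma (β * n + 3) := by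
      have hbn : 0 ≤ β * n := by positivity
      have h := aux_gamma_le (β * n + ν + 1) (β * n + 3) (by linarith) (by linarith)
      rw [Real.Gamma_add_one (hs n).ne'] at h
      have hp := Real.Gamma_pos_of_pos (hs n)
      rw [inv_mul_eq_div, le_div_iff₀ hν0]
      nlinarith
    have hpw : (1 / Real.cos ψ) ^ (β * n + ν) = (1 / Real.cos ψ) ^ ν * ((1 / Real.cos ψ) ^ β) ^ n := by
      rw [Real.rpow_add (by positivity), Real.rpow_mul (by positivity), Real.rpow_natCast, mul_comm]
    rw [hpw, mul_pow]
    calc _ ≤ ‖u‖ ^ n / (n.factorial : ℝ) * ((1 / Real.cos ψ) ^ ν * ((1 / Real.cos ψ) ^ β) ^ n *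
            (ν⁻¹ * Real.Gamma (β * n + 3))) := by gcongr
      _ = _ := by ring

lemma aux_B (β : ℝ) (hβ0 : 0 < β) (ν : ℝ) (hν0 : 0 < ν) 
    (η : ℝ) (h1 : -(π/2) < η) (h2 : η < π/2) (x : ℝ) (hx : 0 < x) :
    ∫ t in Ioi (0:ℝ), ((t ^ (ν - 1) : ℝ) : ℂ) *
        Complex.exp (-(x * Complex.exp (η * Complex.I) * (t ^ β : ℝ))) =
      (β⁻¹ * x ^ (-(ν / β)) * Real.Gamma (ν / β) : ℝ) *
        Complex.exp (-(η * (ν / β : ℝ) * Complex.I)) := by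
  have hr : 0 < (x * Complex.exp (η * Complex.I)).re := by
    rw [Complex.re_ofReal_mul, Complex.exp_ofReal_mul_I_re]
    exact mul_pos hx (Real.cos_pos_of_mem_Ioo ⟨h1, h2⟩)
  have hg := aux_gamma_int η h1 h2 (ν / β) (by positivity)
  have e1 := integral_comp_rpow_Ioi_of_pos (g := fun s : ℝ => ((s ^ (ν / β - 1) : ℝ) : ℂ) *
      Complex.exp (-(Complex.exp (η * Complex.I) * s))) hβ0
  have hxb : 0 < x ^ β⁻¹ := Real.rpow_pos_of_pos hx _
  have e2 := integral_comp_mul_left_Ioi (fun t : ℝ => ((t ^ (ν - 1) : ℝ) : ℂ) *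
        Complex.exp (-(Complex.exp (η * Complex.I) * (t ^ β : ℝ)))) 0 hxb
  rw [hg] at e1
  rw [mul_zero] at e2
  have e3 : ∫ t in Ioi (0:ℝ), ((t ^ (ν - 1) : ℝ) : ℂ) *
        Complex.exp (-(Complex.exp (η * Complex.I) * (t ^ β : ℝ))) =
      (β⁻¹ : ℝ) * (Complex.exp (-(η * (ν / β : ℝ) * Complex.I)) * Complex.Gamma (ν / β : ℝ)) := by
    rw [← e1, ← integral_const_mul]
    refine setIntegral_congr_fun measurableSet_Ioi fun t ht => ?_
    have ht : 0 < t := ht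
    simp only [Complex.real_smul]
    rw [← mul_assoc, ← mul_assoc, ← Complex.ofReal_mul, ← Complex.ofReal_mul]
    congr 2
    rw [← Real.rpow_mul ht.le, mul_sub, mul_div_cancel₀ _ hβ0.ne', ← mul_assoc,
      inv_mul_cancel₀ hβ0.ne', one_mul, ← Real.rpow_add ht]
    congr 1; ring
  rw [e3] at e2
  have e4 : ∫ t in Ioi (0:ℝ), ((t ^ (ν - 1) : ℝ) : ℂ) *
        Complex.exp (-(x * Complex.exp (η * Complex.I) * (t ^ β : ℝ))) =
      ((x ^ β⁻¹) ^ (-(ν - 1)) : ℝ) * ∫ t in Ioi (0:ℝ), (((x ^ β⁻¹ * t) ^ (ν - 1) : ℝ) : ℂ) *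
        Complex.exp (-(Complex.exp (η * Complex.I) * ((x ^ β⁻¹ * t) ^ β : ℝ))) := by
    rw [← integral_const_mul]
    refine setIntegral_congr_fun measurableSet_Ioi fun t ht => ?_
    have ht : 0 < t := ht
    rw [← mul_assoc, ← Complex.ofReal_mul, Real.mul_rpow hxb.le ht.le, ← mul_assoc,
      ← Real.rpow_add hxb, neg_add_cancel, Real.rpow_zero, one_mul, Real.mul_rpow hxb.le ht.le,
      ← Real.rpow_mul hx.le, inv_mul_cancel₀ hβ0.ne', Real.rpow_one]
    push_cast
    congr 3; ring
  rw [e4, e2, Complex.Gamma_ofReal, Complex.real_smul]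
  have : x ^ (-(ν / β)) = (x ^ β⁻¹) ^ (-(ν - 1)) * (x ^ β⁻¹)⁻¹ := by
    rw [← Real.rpow_neg_one (x ^ β⁻¹), ← Real.rpow_add hxb, ← Real.rpow_mul hx.le]
    congr 1; field_simp; ring
  rw [this]
  push_cast
  ring

lemma aux_exp_sub_one (ψ : ℝ) (h1 : -(π/2) < ψ) (h2 : ψ < π/2) (t : ℝ) (ht : 0 < t) :
    ‖Complex.exp (-(Complex.exp (ψ * Complex.I) * t)) - 1‖ ≤ 2 * t := by
  have hc : 0 < Real.cos ψ := Real.cos_pos_of_mem_Ioo ⟨h1, h2⟩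
  have hn : ‖-(Complex.exp (ψ * Complex.I) * t)‖ = t := by
    rw [norm_neg, norm_mul, Complex.norm_exp_ofReal_mul_I, one_mul, Complex.norm_real,
      Real.norm_of_nonneg ht.le]
  rcases le_total t 1 with h | h
  · have := Complex.norm_exp_sub_one_le (x := -(Complex.exp (ψ * Complex.I) * t)) (by rw [hn]; exact h)
    rwa [hn] at this
  · have h3 := norm_sub_le (Complex.exp (-(Complex.exp (ψ * Complex.I) * t))) 1
    rw [aux_norm_exp, norm_one] at h3
    have : Real.exp (-(Real.cos ψ * t)) ≤ 1 := by
      rw [Real.exp_le_one_iff]; have := mul_pos hc ht; linarith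
    linarith

lemma aux_C (β : ℝ) (hβ0 : 0 < β) (hβ1 : β < 1) (ν : ℝ) (hν0 : 0 < ν) 
    (ψ : ℝ) (h1 : -(π/2) < ψ) (h2 : ψ < π/2)
    (η : ℝ) (h3 : -(π/2) < η) (h4 : η < π/2) (x : ℝ) (hx : 0 < x) :
    ‖(∫ t in Ioi (0:ℝ), ((t ^ (ν - 1) : ℝ) : ℂ) * Complex.exp (-(Complex.exp (ψ * Complex.I) * t))
        * Complex.exp (-(x * Complex.exp (η * Complex.I) * (t ^ β : ℝ)))) -
      ∫ t in Ioi (0:ℝ), ((t ^ (ν - 1) : ℝ) : ℂ) *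
        Complex.exp (-(x * Complex.exp (η * Complex.I) * (t ^ β : ℝ)))‖ ≤
      2 * ((x * Real.cos η) ^ (-(ν + 1) / β) * (1 / β) * Real.Gamma ((ν + 1) / β)) := by
  have hc : 0 < Real.cos η := Real.cos_pos_of_mem_Ioo ⟨h3, h4⟩
  have hcp : 0 < Real.cos ψ := Real.cos_pos_of_mem_Ioo ⟨h1, h2⟩
  have hne : ∀ t : ℝ, ‖Complex.exp (-(x * Complex.exp (η * Complex.I) * (t ^ β : ℝ)))‖ =
      Real.exp (-(x * Real.cos η) * t ^ β) := by
    intro t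
    rw [show (x * Complex.exp (η * Complex.I) * (t ^ β : ℝ) : ℂ) =
      Complex.exp (η * Complex.I) * ((x * t ^ β : ℝ) : ℂ) by push_cast; ring, aux_norm_exp]
    congr 1; ring
  have hi0 := integrableOn_rpow_mul_exp_neg_mul_rpow (p := β) (s := ν - 1) (by linarith)
      hβ0 (mul_pos hx hc)
  have hi1 := integrableOn_rpow_mul_exp_neg_mul_rpow (p := β) (s := ν) (by linarith)
      hβ0 (mul_pos hx hc)
  have I2 : IntegrableOn (fun t : ℝ => ((t ^ (ν - 1) : ℝ) : ℂ) *
        Complex.exp (-(x * Complex.exp (η * Complex.I) * (t ^ β : ℝ)))) (Ioi 0) := by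
    refine Integrable.mono' hi0 (Measurable.aestronglyMeasurable (by fun_prop)) ?_
    filter_upwards [ae_restrict_mem measurableSet_Ioi] with t ht
    rw [norm_mul, hne, Complex.norm_real, Real.norm_of_nonneg (Real.rpow_nonneg (le_of_lt ht) _)]
  have I1 : IntegrableOn (fun t : ℝ => ((t ^ (ν - 1) : ℝ) : ℂ) *
        Complex.exp (-(Complex.exp (ψ * Complex.I) * t)) *
        Complex.exp (-(x * Complex.exp (η * Complex.I) * (t ^ β : ℝ)))) (Ioi 0) := by
    refine Integrable.mono' hi0 (Measurable.aestronglyMeasurable (by fun_prop)) ?_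
    filter_upwards [ae_restrict_mem measurableSet_Ioi] with t ht
    have ht : 0 < t := ht
    rw [norm_mul, norm_mul, hne, Complex.norm_real, Real.norm_of_nonneg (Real.rpow_nonneg ht.le _),
      aux_norm_exp]
    have : Real.exp (-(Real.cos ψ * t)) ≤ 1 := by
      rw [Real.exp_le_one_iff]; have := mul_pos hcp ht; linarith
    gcongr
    exact mul_le_of_le_one_right (Real.rpow_nonneg ht.le _) this
  rw [← integral_sub I1 I2, ← integral_rpow_mul_exp_neg_mul_rpow hβ0 (by linarith : -1 < ν)
    (mul_pos hx hc), ← integral_const_mul]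
  refine norm_integral_le_of_norm_le (hi1.const_mul 2) ?_
  filter_upwards [ae_restrict_mem measurableSet_Ioi] with t ht
  have ht : 0 < t := ht
  rw [← sub_mul, ← mul_sub_one, norm_mul, norm_mul, hne, Complex.norm_real,
    Real.norm_of_nonneg (Real.rpow_nonneg ht.le _)]
  have := aux_exp_sub_one ψ h1 h2 t ht
  calc _ ≤ t ^ (ν - 1) * (2 * t) * Real.exp (-(x * Real.cos η) * t ^ β) := by gcongr
    _ = 2 * ((t ^ (ν - 1) * t) * Real.exp (-(x * Real.cos η) * t ^ β)) := by ring
    _ = _ := by rw [← Real.rpow_add_one ht.ne', sub_add_cancel]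

lemma aux_E (β : ℝ) (hβ0 : 0 < β) (hβ1 : β < 1) (ν : ℝ) (hν0 : 0 < ν) (hν1 : ν ≤ 1)
    (ψ : ℝ) (h1 : -(π/2) < ψ) (h2 : ψ < π/2) (θ τ : ℝ)
    (h3 : -(π/2) < θ + β * (ψ + τ)) (h4 : θ + β * (ψ + τ) < π/2) (x : ℝ) (hx : 0 < x) :
    ∃ S : ℂ, HasSum (fun n : ℕ => (-(x * Complex.exp (θ * Complex.I))) ^ n / (n.factorial : ℂ) *
        (Complex.exp (τ * (β * n + ν : ℝ) * Complex.I) * Complex.Gamma (β * n + ν : ℝ))) S ∧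
      ‖S - (β⁻¹ * x ^ (-(ν / β)) * Real.Gamma (ν / β) : ℝ) *
        Complex.exp (-(θ * (ν / β : ℝ) * Complex.I))‖ ≤
      2 * ((x * Real.cos (θ + β * (ψ + τ))) ^ (-(ν + 1) / β) * (1 / β) *
        Real.Gamma ((ν + 1) / β)) := by
  set η := θ + β * (ψ + τ) with hη
  have hA := aux_A β hβ0 hβ1 ν hν0 hν1 ψ h1 h2 (x * Complex.exp (η * Complex.I))
  have hC := aux_C β hβ0 hβ1 ν hν0 ψ h1 h2 η h3 h4 x hx
  rw [aux_B β hβ0 ν hν0 η h3 h4 x hx] at hC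
  refine ⟨_, (hA.mul_left (Complex.exp ((ν * (ψ + τ) : ℝ) * Complex.I))).congr_fun ?_, ?_⟩
  · intro n
    rw [← neg_mul, ← neg_mul, mul_pow, mul_pow, ← Complex.exp_nat_mul, ← Complex.exp_nat_mul]
    have : Complex.exp (n * (θ * Complex.I)) * Complex.exp (τ * (β * n + ν : ℝ) * Complex.I) =
      Complex.exp ((ν * (ψ + τ) : ℝ) * Complex.I) * Complex.exp (n * (η * Complex.I)) *
        Complex.exp (-(ψ * (β * n + ν : ℝ) * Complex.I)) := by
      rw [← Complex.exp_add, ← Complex.exp_add, ← Complex.exp_add]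
      congr 1
      rw [hη]; push_cast; ring
    linear_combination ((-(x:ℂ)) ^ n / (n.factorial : ℂ) * Complex.Gamma (β * n + ν : ℝ)) * this
  · refine le_trans (le_of_eq ?_) hC
    have e : Complex.exp (-(θ * (ν / β : ℝ) * Complex.I)) =
      Complex.exp ((ν * (ψ + τ) : ℝ) * Complex.I) * Complex.exp (-(η * (ν / β : ℝ) * Complex.I)) := by
      rw [← Complex.exp_add]
      congr 1
      have : (β : ℂ) ≠ 0 := by exact_mod_cast hβ0.ne'
      rw [hη]; push_cast; field_simp; ring
    rw [e, mul_left_comm, ← mul_sub, norm_mul, Complex.norm_exp_ofReal_mul_I, one_mul]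

lemma aux_bd (β : ℝ) (hβ0 : 0 < β) (hβ1 : β < 1/3) (ν : ℝ) (hν0 : 0 < ν) (hν1 : ν ≤ 1)
    (c : ℝ) (hc : 0 < c) (x : ℝ) (hx : 1 / c ≤ x) :
    2 * ((x * c) ^ (-(ν + 1) / β) * (1 / β) * Real.Gamma ((ν + 1) / β)) ≤
      (2 * (c ^ (-1 / β) * (1 / β) * Real.Gamma (2 / β))) * x ^ (-1 / β) := by
  have hx0 : 0 < x := lt_of_lt_of_le (by positivity) hx
  have h1 : 1 ≤ x * c := by rwa [div_le_iff₀ hc] at hx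
  have h2 : (x * c) ^ (-(ν + 1) / β) ≤ x ^ (-1 / β) * c ^ (-1 / β) := by
    rw [← Real.mul_rpow hx0.le hc.le]
    refine Real.rpow_le_rpow_of_exponent_le h1 ?_
    gcongr; linarith
  have h3 : Real.Gamma ((ν + 1) / β) ≤ Real.Gamma (2 / β) := by
    have : (2:ℝ) ≤ (ν + 1) / β := by rw [le_div_iff₀ hβ0]; linarith
    have h' : (ν + 1) / β ≤ 2 / β := by gcongr; linarith
    exact Real.Gamma_strictMonoOn_Ici.monotoneOn this (this.trans h') h'
  have hg : 0 < Real.Gamma ((ν + 1) / β) := Real.Gamma_pos_of_pos (by positivity)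
  calc _ ≤ 2 * ((x ^ (-1 / β) * c ^ (-1 / β)) * (1 / β) * Real.Gamma (2 / β)) := by gcongr
    _ = _ := by ring

lemma aux_unif (β : ℝ) (hβ0 : 0 < β) (hβ1 : β < 1/3) (θ ψ₁ ψ₂ : ℝ)
    (h1 : -(π/2) < ψ₁) (h2 : ψ₁ < π/2) (k1 : -(π/2) < ψ₂) (k2 : ψ₂ < π/2)
    (h3 : -(π/2) < θ + β * (ψ₁ + π)) (h4 : θ + β * (ψ₁ + π) < π/2)
    (k3 : -(π/2) < θ + β * (ψ₂ + -π)) (k4 : θ + β * (ψ₂ + -π) < π/2) :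
    ∃ C X : ℝ, 0 < X ∧ ∀ ν : ℝ, 0 < ν → ν ≤ 1 → ∀ x, X ≤ x →
      ‖wrightPhi (-(β : ℂ)) (1 - ν) (-(x * Complex.exp (θ * Complex.I)))‖ ≤ C * x ^ (-1 / β) := by
  have hc1 : 0 < Real.cos (θ + β * (ψ₁ + π)) := Real.cos_pos_of_mem_Ioo ⟨h3, h4⟩
  have hc2 : 0 < Real.cos (θ + β * (ψ₂ + -π)) := Real.cos_pos_of_mem_Ioo ⟨k3, k4⟩
  refine ⟨(2 * ((Real.cos (θ + β * (ψ₁ + π))) ^ (-1 / β) * (1 / β) * Real.Gamma (2 / β))) +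
    (2 * ((Real.cos (θ + β * (ψ₂ + -π))) ^ (-1 / β) * (1 / β) * Real.Gamma (2 / β))),
    max (1 / Real.cos (θ + β * (ψ₁ + π))) (1 / Real.cos (θ + β * (ψ₂ + -π))),
    lt_max_of_lt_left (by positivity), ?_⟩
  intro ν hν0 hν1 x hx
  have hx1 := (le_max_left _ _).trans hx
  have hx2 := (le_max_right _ _).trans hx
  have hx0 : 0 < x := lt_of_lt_of_le (by positivity) hx1
  obtain ⟨S1, s1, b1⟩ := aux_E β hβ0 (by linarith) ν hν0 hν1 ψ₁ h1 h2 θ π h3 h4 x hx0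
  obtain ⟨S2, s2, b2⟩ := aux_E β hβ0 (by linarith) ν hν0 hν1 ψ₂ k1 k2 θ (-π) k3 k4 x hx0
  replace b1 := b1.trans (aux_bd β hβ0 hβ1 ν hν0 hν1 _ hc1 x hx1)
  replace b2 := b2.trans (aux_bd β hβ0 hβ1 ν hν0 hν1 _ hc2 x hx2)
  have hpi : (π : ℂ) ≠ 0 := by exact_mod_cast pi_ne_zero
  have hφ : wrightPhi (-(β : ℂ)) (1 - ν) (-(x * Complex.exp (θ * Complex.I))) =
      (2 * π * Complex.I)⁻¹ * (S1 - S2) := by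
    unfold wrightPhi
    refine HasSum.tsum_eq (((s1.sub s2).mul_left _).congr_fun ?_)
    intro n
    have hs : 0 < β * n + ν := by positivity
    have hi := aux_inv_gamma (β * n + ν) hs
    have e1 : -(β:ℂ) * n + (1 - ν) = 1 - (β * n + ν : ℝ) := by push_cast; ring
    rw [e1, ← div_div, div_eq_mul_inv _ (Complex.Gamma _), hi, Complex.sin]
    have e2 : Complex.exp ((-π : ℝ) * (β * n + ν : ℝ) * Complex.I) =
      Complex.exp (-(π * (β * n + ν : ℝ)) * Complex.I) := by push_cast; ring_nf
    rw [e2]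
    field_simp
    rw [Complex.I_sq]
    ring
  rw [hφ, norm_mul]
  have hn : ‖(2 * π * Complex.I : ℂ)⁻¹‖ ≤ 1 := by
    rw [norm_inv]
    simp only [norm_mul, Complex.norm_I, mul_one, Complex.norm_real, Complex.norm_ofNat]
    rw [Real.norm_of_nonneg pi_pos.le]
    exact inv_le_one_of_one_le₀ (by linarith [pi_gt_three])
  refine (mul_le_of_le_one_left (norm_nonneg _) hn).trans ?_
  rw [add_mul]
  refine le_trans ?_ (add_le_add b1 b2)
  refine le_trans (le_of_eq ?_) (norm_sub_le _ _)
  congr 1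
  ring

lemma aux_lim (β : ℝ) (hβ0 : 0 < β) (hβ1 : β < 1) (z : ℂ) :
    Tendsto (fun ν : ℝ => wrightPhi (-(β : ℂ)) (1 - ν) z) (𝓝[>] 0)
      (𝓝 (wrightPhi (-(β : ℂ)) 1 z)) := by
  unfold wrightPhi
  refine tendsto_tsum_of_dominated_convergence (aux_summ β hβ0 hβ1 ‖z‖ (norm_nonneg _)) ?_ ?_
  · intro n
    have hc : Continuous (fun ν : ℝ => z ^ n / ((n.factorial : ℂ) *
        Complex.Gamma (-(β : ℂ) * n + (1 - ν)))) := by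
      have h := Complex.differentiable_one_div_Gamma.continuous
      have h' := h.comp (by fun_prop : Continuous (fun ν : ℝ => -(β : ℂ) * n + (1 - ν)))
      refine (h'.const_mul (z ^ n / (n.factorial : ℂ))).congr fun ν => ?_
      simp only [Function.comp]
      rw [← div_div, div_eq_mul_inv _ (Complex.Gamma _)]
    refine (hc.tendsto' 0 _ (by simp)).mono_left nhdsWithin_le_nhds
  · have : Ioo (0:ℝ) 1 ∈ 𝓝[>] (0:ℝ) := Ioo_mem_nhdsGT one_pos
    filter_upwards [this] with ν hν n
    exact aux_term β hβ0 ν hν.1.le hν.2.le z n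

lemma aux_ray (β : ℝ) (hβ0 : 0 < β) (hβ1 : β < 1/3) (θ ψ₁ ψ₂ : ℝ)
    (h1 : -(π/2) < ψ₁) (h2 : ψ₁ < π/2) (k1 : -(π/2) < ψ₂) (k2 : ψ₂ < π/2)
    (h3 : -(π/2) < θ + β * (ψ₁ + π)) (h4 : θ + β * (ψ₁ + π) < π/2)
    (k3 : -(π/2) < θ + β * (ψ₂ + -π)) (k4 : θ + β * (ψ₂ + -π) < π/2) (e : ℂ)
    (he : e = -Complex.exp (θ * Complex.I)) :
    IntegrableOn (fun x : ℝ => wrightPhi (-(β : ℂ)) (1 - β) (e * x)) (Ioi 0) ∧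
    e * ∫ x in Ioi (0:ℝ), wrightPhi (-(β : ℂ)) (1 - β) (e * x) = -1 := by
  obtain ⟨C, X, hX, hb⟩ := aux_unif β hβ0 hβ1 θ ψ₁ ψ₂ h1 h2 k1 k2 h3 h4 k3 k4
  have harg : ∀ x : ℝ, -((x : ℂ) * Complex.exp (θ * Complex.I)) = e * x := by
    intro x; rw [he]; ring
  simp only [harg] at hb
  have hβ : -1 / β < -1 := by rw [div_lt_iff₀ hβ0]; linarith
  have hcont : Continuous (fun x : ℝ => wrightPhi (-(β : ℂ)) (1 - β) (e * x)) := by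
    have : Continuous (fun z : ℂ => wrightPhi (-(β : ℂ)) (1 - β) z) :=
      continuous_iff_continuousAt.mpr fun z =>
        (aux_deriv β hβ0 (by linarith) β hβ0.le (by linarith) z).continuousAt
    exact this.comp (by fun_prop)
  have hint : IntegrableOn (fun x : ℝ => wrightPhi (-(β : ℂ)) (1 - β) (e * x)) (Ioi 0) := by
    rw [← Ioc_union_Ioi_eq_Ioi hX.le]
    refine IntegrableOn.union ?_ ?_
    · exact (hcont.integrableOn_Icc).mono_set Ioc_subset_Icc_self
    · refine Integrable.mono' ((integrableOn_Ioi_rpow_of_lt hβ hX).const_mul C)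
        hcont.aestronglyMeasurable ?_
      filter_upwards [ae_restrict_mem measurableSet_Ioi] with x hx
      exact hb β hβ0 (by linarith) x (le_of_lt hx)
  refine ⟨hint, ?_⟩
  have hlim : Tendsto (fun x : ℝ => wrightPhi (-(β : ℂ)) 1 (e * x)) atTop (𝓝 0) := by
    have hz : Tendsto (fun x : ℝ => C * x ^ (-1 / β)) atTop (𝓝 0) := by
      have := (tendsto_rpow_neg_atTop (show 0 < 1 / β by positivity)).const_mul C
      rw [mul_zero] at this
      simpa only [neg_div] using this
    refine squeeze_zero_norm' ?_ hz
    filter_upwards [eventually_ge_atTop X] with x hx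
    refine le_of_tendsto (aux_lim β hβ0 (by linarith) (e * x)).norm ?_
    have : Ioo (0:ℝ) 1 ∈ 𝓝[>] (0:ℝ) := Ioo_mem_nhdsGT one_pos
    filter_upwards [this] with ν hν
    exact hb ν hν.1 hν.2.le x hx
  have hd : ∀ x : ℝ, HasDerivAt (fun x : ℝ => wrightPhi (-(β : ℂ)) 1 (e * x))
      (wrightPhi (-(β : ℂ)) (1 - β) (e * x) * e) x := by
    intro x
    have h := aux_deriv β hβ0 (by linarith) 0 le_rfl zero_le_one (e * x)
    simp only [Complex.ofReal_zero, sub_zero] at h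
    have h2 : HasDerivAt (fun x : ℝ => e * (x : ℂ)) e x := by
      simpa using (Complex.ofRealCLM.hasDerivAt (x := x)).const_mul e
    exact h.comp x h2
  have hF := integral_Ioi_of_hasDerivAt_of_tendsto (hd 0).continuousAt.continuousWithinAt
    (fun x _ => hd x) (hint.mul_const e) hlim
  rw [integral_mul_const, mul_comm] at hF
  rw [hF]
  have : wrightPhi (-(β : ℂ)) 1 0 = 1 := by
    unfold wrightPhi
    rw [tsum_eq_single 0]
    · simp
    · intro n hn; simp [hn]
  simp [this]

/-- The spatial profile `g_α` of the fundamental solution `G_α^{1−α/3}` is integrable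
on `ℝ` with total integral `1`; equivalently
`(1/3)∫_{−∞}^0 φ(−α/3,1−α/3;y)dy − (2/3)Re[e^{2πi/3}∫_0^∞ φ(−α/3,1−α/3;e^{2πi/3}y)dy] = 1`. -/
theorem gA_integral_eq_one (α : ℝ) (hα0 : 0 < α) (hα1 : α < 1) :
    MeasureTheory.Integrable (gA α) ∧
    (∫ y, gA α y) = 1 ∧
    (1/3) * (∫ y in Set.Iio (0:ℝ), (wrightPhi (-(α/3)) (1 - α/3) (y : ℂ)).re) -
      (2/3) * (e23 * ∫ y in Set.Ioi (0:ℝ),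
        wrightPhi (-(α/3)) (1 - α/3) (e23 * (y : ℂ))).re = 1 := by
  set β := α / 3 with hβ
  have hβ0 : 0 < β := by positivity
  have hβ1 : β < 1 / 3 := by rw [hβ]; linarith
  have hcast : (α : ℂ) / 3 = (β : ℂ) := by rw [hβ]; push_cast; rfl
  have hgA : gA α = fun y : ℝ => if y < 0 then (1/3) * (wrightPhi (-(β : ℂ)) (1 - β) (y : ℂ)).re
      else -(2/3) * (e23 * wrightPhi (-(β : ℂ)) (1 - β) (e23 * (y : ℂ))).re := by
    funext y
    rw [gA, hcast]
  rw [hgA, hcast]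
  have hpi := pi_pos
  have hbp : 0 < β * π := by positivity
  have hbp3 : β * π < π / 3 := by nlinarith
  obtain ⟨i1, v1⟩ := aux_ray β hβ0 hβ1 0 0 0 (by linarith) (by linarith) (by linarith)
    (by linarith) (by linarith) (by linarith) (by linarith) (by linarith) (-1) (by simp)
  have he : e23 = -Complex.exp ((-(π / 3) : ℝ) * Complex.I) := by
    rw [e23, ← Complex.exp_add_pi_mul_I]
    congr 1; push_cast; ring
  obtain ⟨ψ, hψ1, hψ2⟩ : ∃ ψ, max 0 (π - π / (6 * β)) < ψ ∧ ψ < π / 2 := by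
    apply exists_between
    rw [max_lt_iff]
    refine ⟨by positivity, ?_⟩
    have : π / 2 < π / (6 * β) := by
      gcongr; linarith
    linarith
  rw [max_lt_iff] at hψ1
  have hψ3 : β * (π - ψ) < π / 6 := by
    have h : π - ψ < π / (6 * β) := by linarith [hψ1.2]
    rw [lt_div_iff₀ (by positivity)] at h
    linarith
  have hψ4 : 0 < β * (π - ψ) := mul_pos hβ0 (by linarith)
  obtain ⟨i2, v2⟩ := aux_ray β hβ0 hβ1 (-(π / 3)) 0 ψ (by linarith) (by linarith)
    (by linarith) (by linarith) (by linarith) (by linarith) (by linarith) (by linarith) e23 he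
  set f : ℂ → ℂ := fun z => wrightPhi (-(β : ℂ)) (1 - β) z with hf
  have i1' : IntegrableOn (fun y : ℝ => (f y).re) (Iio 0) := by
    have h : IntegrableOn (fun y : ℝ => (f (-1 * y)).re) (Ioi (-0)) := by
      rw [neg_zero]; exact i1.re
    have h2 := h.comp_neg_Iio
    refine h2.congr_fun (fun y _ => ?_) measurableSet_Iio
    simp
  have v1' : ∫ y in Iio (0:ℝ), (f y).re = 1 := by
    have h := integral_comp_neg_Ioi (0:ℝ) (fun y : ℝ => (f y).re)
    rw [neg_zero, integral_Iic_eq_integral_Iio] at h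
    rw [← h]
    have h3 := integral_re (i1.const_mul (-1))
    rw [integral_const_mul, v1] at h3
    simp only [neg_mul, one_mul, RCLike.re_to_complex, Complex.neg_re, Complex.one_re,
      integral_neg] at h3
    have h4 := neg_injective h3
    rw [← h4]
    simp only [hf, Complex.ofReal_neg]
  have i2' : IntegrableOn (fun y : ℝ => (e23 * f (e23 * y)).re) (Ioi 0) := (i2.const_mul e23).re
  have v2' : ∫ y in Ioi (0:ℝ), (e23 * f (e23 * y)).re = -1 := by
    have := integral_re (i2.const_mul e23)
    rw [integral_const_mul, v2] at this
    simpa using this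
  have j1 : EqOn (fun y : ℝ => (1/3) * (f y).re) (fun y : ℝ => if y < 0 then (1/3) * (f y).re
      else -(2/3) * (e23 * f (e23 * y)).re) (Iio 0) := fun y hy => (if_pos hy).symm
  have j2 : EqOn (fun y : ℝ => -(2/3) * (e23 * f (e23 * y)).re)
      (fun y : ℝ => if y < 0 then (1/3) * (f y).re
      else -(2/3) * (e23 * f (e23 * y)).re) (Ici 0) := fun y hy => (if_neg (not_lt.mpr hy)).symm
  have I1 := IntegrableOn.congr_fun (i1'.const_mul (1/3)) j1 measurableSet_Iio
  have i3 : IntegrableOn (fun y : ℝ => (e23 * f (e23 * y)).re) (Ici 0) := by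
    rw [integrableOn_Ici_iff_integrableOn_Ioi]; exact i2'
  have I2 := IntegrableOn.congr_fun (Integrable.const_mul i3 (-(2/3))) j2
    measurableSet_Ici
  have hI : Integrable (fun y : ℝ => if y < 0 then (1/3) * (f y).re
      else -(2/3) * (e23 * f (e23 * y)).re) := by
    rw [← integrableOn_univ, ← Iio_union_Ici (a := (0:ℝ))]
    exact I1.union I2
  refine ⟨hI, ?_, ?_⟩
  · rw [← setIntegral_univ, ← Iio_union_Ici (a := (0:ℝ)),
      setIntegral_union (by rw [Set.disjoint_left]; intro y hy hy'; exact absurd (Set.mem_Iio.mp hy) (not_lt.mpr (Set.mem_Ici.mp hy')))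
        measurableSet_Ici I1 I2, ← setIntegral_congr_fun measurableSet_Iio j1,
      ← setIntegral_congr_fun measurableSet_Ici j2, integral_const_mul, integral_const_mul,
      integral_Ici_eq_integral_Ioi, v1', v2']
    norm_num
  · rw [v1', v2]
    norm_num
end
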